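/- Let p, q be positive integers. The number of partitions in NC^B(p,q) with connectivity equal to 0 is exactly C(2p, p) · C(2q, q). -/

import Mathlib

/-!  Common setup: annular non-crossing partitions of type B, following
Goulden–Nica–Oancea, "Enumerative properties of NC^(B)(p,q)". -/

/-- The underlying set `{±1, …, ±n}`, realized inside `ℤ`. -/
def signedSet (n : ℕ) : Set ℤ := {x : ℤ | x ≠ 0 ∧ |x| ≤ (n : ℤ)}

/-- Membership in the hyperoctahedral group `B_n`, realized as the permutations of `ℤ`
that commute with negation and fix every point outside `{±1, …, ±n}`. -/
def inB (n : ℕ) (π : Equiv.Perm ℤ) : Prop :=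
  (∀ x : ℤ, π (-x) = -(π x)) ∧ ∀ x : ℤ, x ∉ signedSet n → π x = x

/-- The set of generators of `B_n`:
`(i,j)(-i,-j)`, `(i,-j)(-i,j)` for `1 ≤ i ≠ j ≤ n`, and `(i,-i)` for `1 ≤ i ≤ n`. -/
def genB (n : ℕ) : Set (Equiv.Perm ℤ) :=
  {π | (∃ i j : ℤ, 1 ≤ i ∧ i ≤ (n : ℤ) ∧ 1 ≤ j ∧ j ≤ (n : ℤ) ∧ i ≠ j ∧
          π = Equiv.swap i j * Equiv.swap (-i) (-j)) ∨
       (∃ i j : ℤ, 1 ≤ i ∧ i ≤ (n : ℤ) ∧ 1 ≤ j ∧ j ≤ (n : ℤ) ∧ i ≠ j ∧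
          π = Equiv.swap i (-j) * Equiv.swap (-i) j) ∨
       (∃ i : ℤ, 1 ≤ i ∧ i ≤ (n : ℤ) ∧ π = Equiv.swap i (-i))}

/-- The length function `ℓ_B` on `B_n`: the least `k` such that `τ` is a product of `k`
generators from `genB n` (the empty product being the identity). -/
noncomputable def lenB (n : ℕ) (τ : Equiv.Perm ℤ) : ℕ :=
  sInf {k : ℕ | ∃ l : List (Equiv.Perm ℤ),
    l.length = k ∧ (∀ g ∈ l, g ∈ genB n) ∧ l.prod = τ}

/-- The partial order on `B_n`:  `τ ≤ σ` iff `ℓ_B(σ) = ℓ_B(τ) + ℓ_B(τ⁻¹σ)`. -/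
def leB (n : ℕ) (τ σ : Equiv.Perm ℤ) : Prop :=
  lenB n σ = lenB n τ + lenB n (τ⁻¹ * σ)

/-- The permutation `γ_{p,q} = (1,…,p,-1,…,-p)(p+1,…,p+q,-(p+1),…,-(p+q))`. -/
def gammaPQ (p q : ℕ) : Equiv.Perm ℤ :=
  (((List.range p).map fun i => ((i : ℤ) + 1)) ++
      ((List.range p).map fun i => -((i : ℤ) + 1))).formPerm *
    (((List.range q).map fun i => ((p : ℤ) + (i : ℤ) + 1)) ++
      ((List.range q).map fun i => -((p : ℤ) + (i : ℤ) + 1))).formPerm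

/-- The long cycle `γ_n = (1,…,n,-1,…,-n)` of `B_n` (disc case). -/
def gammaDisc (n : ℕ) : Equiv.Perm ℤ :=
  (((List.range n).map fun i => ((i : ℤ) + 1)) ++
    ((List.range n).map fun i => -((i : ℤ) + 1))).formPerm

/-- The annular non-crossing permutations of type B: `S^B_nc(p,q) = [ε, γ_{p,q}] ⊆ B_{p+q}`. -/
def SncB (p q : ℕ) : Set (Equiv.Perm ℤ) :=
  {τ | inB (p + q) τ ∧ leB (p + q) τ (gammaPQ p q)}

/-- The orbit of `x` under the permutation `τ`. -/
def permOrbit (τ : Equiv.Perm ℤ) (x : ℤ) : Set ℤ := {y | ∃ m : ℤ, (τ ^ m) x = y}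

/-- The partition `Ω(τ)` of `{±1,…,±n}` into orbits of `τ`. -/
def orbitsOn (n : ℕ) (τ : Equiv.Perm ℤ) : Set (Set ℤ) :=
  {A | ∃ x ∈ signedSet n, A = permOrbit τ x}

/-- The negation `-A` of a set `A ⊆ ℤ`. -/
def negSet (A : Set ℤ) : Set ℤ := {x | -x ∈ A}

/-- The partition `Ω̃(τ)`, obtained from `Ω(τ)` by merging all inversion-invariant orbits
(orbits `A` with `A = -A`) into a single block. -/
def omegaTilde (n : ℕ) (τ : Equiv.Perm ℤ) : Set (Set ℤ) :=
  {A | A ∈ orbitsOn n τ ∧ negSet A ≠ A} ∪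
    {B | B = ⋃₀ {A | A ∈ orbitsOn n τ ∧ negSet A = A} ∧ B.Nonempty}

/-- The annular non-crossing partitions of type B: `NC^B(p,q) = {Ω̃(τ) : τ ∈ S^B_nc(p,q)}`. -/
def NCB (p q : ℕ) : Set (Set (Set ℤ)) :=
  {π | ∃ τ ∈ SncB p q, π = omegaTilde (p + q) τ}

/-- The type B non-crossing partitions of the disc: `NC^B(n) = {Ω̃(τ) : τ ∈ B_n, τ ≤ γ_n}`. -/
def NCBdisc (n : ℕ) : Set (Set (Set ℤ)) :=
  {π | ∃ τ, inB n τ ∧ leB n τ (gammaDisc n) ∧ π = omegaTilde n τ}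

/-- Reverse refinement order on partitions: every block of `π` is contained in a block of `ρ`. -/
def refines (π ρ : Set (Set ℤ)) : Prop := ∀ A ∈ π, ∃ B ∈ ρ, A ⊆ B

/-- The rank of a partition of `{±1,…,±n}`:
`n` minus half the number of blocks `A` with `A ≠ -A`. -/
noncomputable def rankNCB (n : ℕ) (π : Set (Set ℤ)) : ℕ :=
  n - {A | A ∈ π ∧ negSet A ≠ A}.ncard / 2

/-- The inner point set `{±(p+1), …, ±(p+q)}`. -/
def innerSet (p q : ℕ) : Set ℤ := {x : ℤ | (p : ℤ) < |x| ∧ |x| ≤ (p : ℤ) + (q : ℤ)}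

/-- The connectivity of `π ∈ NC^B(p,q)`: half the number of blocks `A` with `A ≠ -A`
meeting both `{±1,…,±p}` and `{±(p+1),…,±(p+q)}`. -/
noncomputable def connectivity (p q : ℕ) (π : Set (Set ℤ)) : ℕ :=
  {A | A ∈ π ∧ negSet A ≠ A ∧ (A ∩ signedSet p).Nonempty ∧
    (A ∩ innerSet p q).Nonempty}.ncard / 2

/-- The number of exterior pairs of blocks `{A, -A}` (with `A ≠ -A`, `A ⊆ {±1,…,±p}`). -/
noncomputable def extPairs (p : ℕ) (π : Set (Set ℤ)) : ℕ :=
  {A | A ∈ π ∧ negSet A ≠ A ∧ A ⊆ signedSet p}.ncard / 2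

/-- The number of interior pairs of blocks `{A, -A}`
(with `A ≠ -A`, `A ⊆ {±(p+1),…,±(p+q)}`). -/
noncomputable def intPairs (p q : ℕ) (π : Set (Set ℤ)) : ℕ :=
  {A | A ∈ π ∧ negSet A ≠ A ∧ A ⊆ innerSet p q}.ncard / 2

/-- The minimum `0̂` of `NC^B(p,q)` (with `n = p+q`): the partition into singletons. -/
def botNCB (n : ℕ) : Set (Set ℤ) := {A | ∃ x ∈ signedSet n, A = {x}}

/-- The maximum `1̂` of `NC^B(p,q)` (with `n = p+q`): the partition with a single block. -/
def topNCB (n : ℕ) : Set (Set ℤ) := {signedSet n}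

/-- The orbit of `x` under the subgroup generated by `{τ, γ}`. -/
def jointOrbit (τ γ : Equiv.Perm ℤ) (x : ℤ) : Set ℤ :=
  {y | ∃ g ∈ Subgroup.closure ({τ, γ} : Set (Equiv.Perm ℤ)), g x = y}

/-- The orbits on `{±1,…,±n}` of the subgroup generated by `{τ, γ}`. -/
def jointOrbitsOn (n : ℕ) (τ γ : Equiv.Perm ℤ) : Set (Set ℤ) :=
  {Y | ∃ x ∈ signedSet n, Y = jointOrbit τ γ x}

open Classical in
/-- odd functions supported on the signed set -/
def Vs (N : ℕ) : Submodule ℚ (ℤ → ℚ) where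
  carrier := {v | (∀ x, v (-x) = - v x) ∧ ∀ x, x ∉ signedSet N → v x = 0}
  add_mem' := by
    rintro a b ⟨h1, h2⟩ ⟨h3, h4⟩
    refine ⟨fun x => ?_, fun x hx => ?_⟩
    · simp [h1 x, h3 x]; ring
    · simp [h2 x hx, h4 x hx]
  zero_mem' := by simp
  smul_mem' := by
    rintro c a ⟨h1, h2⟩
    refine ⟨fun x => ?_, fun x hx => ?_⟩
    · simp [h1 x]
    · simp [h2 x hx]

def Fx (N : ℕ) (τ : Equiv.Perm ℤ) : Submodule ℚ (ℤ → ℚ) where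
  carrier := {v | v ∈ Vs N ∧ ∀ x, v (τ x) = v x}
  add_mem' := by
    rintro a b ⟨h1, h2⟩ ⟨h3, h4⟩
    exact ⟨(Vs N).add_mem h1 h3, fun x => by simp [h2 x, h4 x]⟩
  zero_mem' := ⟨(Vs N).zero_mem, by simp⟩
  smul_mem' := by
    rintro c a ⟨h1, h2⟩
    exact ⟨(Vs N).smul_mem c h1, fun x => by simp [h2 x]⟩

lemma mem_Vs {N : ℕ} {v : ℤ → ℚ} : v ∈ Vs N ↔ (∀ x, v (-x) = - v x) ∧ ∀ x, x ∉ signedSet N → v x = 0 := Iff.rfl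

lemma mem_Fx {N : ℕ} {τ : Equiv.Perm ℤ} {v : ℤ → ℚ} : v ∈ Fx N τ ↔ v ∈ Vs N ∧ ∀ x, v (τ x) = v x := Iff.rfl

lemma Fx_le (N : ℕ) (τ : Equiv.Perm ℤ) : Fx N τ ≤ Vs N := fun _ h => h.1

instance Vs_fin (N : ℕ) : FiniteDimensional ℚ (Vs N) := by
  let f : Vs N →ₗ[ℚ] (Fin (N+1) → ℚ) :=
    { toFun := fun v i => v.1 (i : ℤ)
      map_add' := fun _ _ => rfl
      map_smul' := fun _ _ => rfl }
  apply Module.Finite.of_injective f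
  rw [injective_iff_map_eq_zero]
  rintro ⟨v, hv⟩ h
  have key : ∀ i : ℕ, v i = 0 := by
    intro i
    by_cases hi : i < N + 1
    · exact congrFun h ⟨i, hi⟩
    · apply hv.2
      simp only [signedSet, Set.mem_ofPred_eq, not_and, not_le]
      intro _
      rw [abs_of_nonneg (by positivity)]; omega
  ext x
  show v x = 0
  obtain ⟨n, rfl | rfl⟩ := Int.eq_nat_or_neg x
  · exact key n
  · rw [hv.1, key, neg_zero]

instance Fx_fin (N : ℕ) (τ : Equiv.Perm ℤ) : FiniteDimensional ℚ (Fx N τ) :=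
  Submodule.finiteDimensional_of_le (Fx_le N τ)

noncomputable def dd (N : ℕ) (τ : Equiv.Perm ℤ) : ℕ := Module.finrank ℚ (Fx N τ)
noncomputable def DD (N : ℕ) : ℕ := Module.finrank ℚ (Vs N)
noncomputable def Ln (N : ℕ) (τ : Equiv.Perm ℤ) : ℕ := DD N - dd N τ

lemma dd_le (N : ℕ) (τ : Equiv.Perm ℤ) : dd N τ ≤ DD N := Submodule.finrank_mono (Fx_le N τ)

lemma Ln_add (N : ℕ) (τ : Equiv.Perm ℤ) : Ln N τ + dd N τ = DD N := by
  have := dd_le N τ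
  unfold Ln; omega

lemma Fx_inf_le (N : ℕ) (a b : Equiv.Perm ℤ) : Fx N a ⊓ Fx N b ≤ Fx N (a * b) := by
  rintro v ⟨h1, h2⟩
  exact ⟨h1.1, fun x => by rw [Equiv.Perm.mul_apply, h1.2, h2.2]⟩

lemma Fx_inv (N : ℕ) (a : Equiv.Perm ℤ) : Fx N a⁻¹ = Fx N a := by
  ext v
  constructor
  · rintro ⟨h1, h2⟩
    exact ⟨h1, fun x => by simpa using (h2 (a x)).symm⟩
  · rintro ⟨h1, h2⟩
    exact ⟨h1, fun x => by simpa using (h2 (a⁻¹ x)).symm⟩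

lemma Ln_inv (N : ℕ) (a : Equiv.Perm ℤ) : Ln N a⁻¹ = Ln N a := by
  unfold Ln dd; rw [Fx_inv]

lemma Ln_mul (N : ℕ) (a b : Equiv.Perm ℤ) : Ln N (a * b) ≤ Ln N a + Ln N b := by
  have h1 := Submodule.finrank_sup_add_finrank_inf_eq (Fx N a) (Fx N b)
  have h2 : Module.finrank ℚ ↥(Fx N a ⊔ Fx N b) ≤ DD N :=
    Submodule.finrank_mono (sup_le (Fx_le N a) (Fx_le N b))
  have h3 : Module.finrank ℚ ↥(Fx N a ⊓ Fx N b) ≤ dd N (a * b) :=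
    Submodule.finrank_mono (Fx_inf_le N a b)
  have := Ln_add N a
  have := Ln_add N b
  have := Ln_add N (a * b)
  unfold dd at *
  omega

lemma Ln_one (N : ℕ) : Ln N 1 = 0 := by
  have : Fx N 1 = Vs N := by
    ext v; simp [mem_Fx]
  unfold Ln dd DD
  rw [this]; simp

/-- reflections -/
def rfn (i x : ℤ) : Equiv.Perm ℤ :=
  if x = -i then Equiv.swap i (-i) else Equiv.swap i x * Equiv.swap (-i) (-x)

lemma rfn_self (i : ℤ) : rfn i i = 1 := by
  unfold rfn
  split_ifs with h
  · rw [← h]; exact Equiv.swap_self i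
  · rw [Equiv.swap_self, Equiv.swap_self]; rfl

lemma rfn_apply {i x : ℤ} (hi : i ≠ 0) (hx : x ≠ 0) (z : ℤ) :
    rfn i x z = if z = i then x else if z = x then i else if z = -i then -x else
      if z = -x then -i else z := by
  unfold rfn
  by_cases h : x = -i
  · subst h
    simp only [if_true, Equiv.swap_apply_def, neg_neg]
    split_ifs <;> simp_all
  · rw [if_neg h, Equiv.Perm.mul_apply]
    simp only [Equiv.swap_apply_def]
    split_ifs <;> (try subst_vars) <;> first | rfl | omega

lemma rfn_mul_self {i x : ℤ} (hi : i ≠ 0) (hx : x ≠ 0) : rfn i x * rfn i x = 1 := by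
  ext z
  rw [Equiv.Perm.mul_apply, rfn_apply hi hx z, Equiv.Perm.one_apply, rfn_apply hi hx]
  split_ifs <;> omega

lemma rfn_inv {i x : ℤ} (hi : i ≠ 0) (hx : x ≠ 0) : (rfn i x)⁻¹ = rfn i x :=
  inv_eq_of_mul_eq_one_left (rfn_mul_self hi hx)

lemma mem_signed_neg {N : ℕ} {x : ℤ} : -x ∈ signedSet N ↔ x ∈ signedSet N := by
  simp [signedSet]

lemma inB_rfn {N : ℕ} {i x : ℤ} (hi : i ∈ signedSet N) (hx : x ∈ signedSet N) :
    inB N (rfn i x) := by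
  have hi0 := hi.1
  have hx0 := hx.1
  constructor
  · intro z
    rw [rfn_apply hi.1 hx.1, rfn_apply hi.1 hx.1]
    split_ifs <;> omega
  · intro z hz
    rw [rfn_apply hi.1 hx.1]
    have h1 : z ≠ i := fun h => hz (h ▸ hi)
    have h2 : z ≠ x := fun h => hz (h ▸ hx)
    have h3 : z ≠ -i := fun h => hz (h ▸ mem_signed_neg.2 hi)
    have h4 : z ≠ -x := fun h => hz (h ▸ mem_signed_neg.2 hx)
    simp [h1, h2, h3, h4]

lemma inB_mul {N : ℕ} {a b : Equiv.Perm ℤ} (ha : inB N a) (hb : inB N b) : inB N (a * b) :=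
  ⟨fun x => by simp [hb.1, ha.1], fun x hx => by simp [hb.2 x hx, ha.2 x hx]⟩

lemma inB_one (N : ℕ) : inB N 1 := ⟨fun x => by simp, fun x _ => by simp⟩

lemma inB_inv {N : ℕ} {a : Equiv.Perm ℤ} (ha : inB N a) : inB N a⁻¹ :=
  ⟨fun x => by rw [Equiv.Perm.inv_eq_iff_eq, ha.1]; simp,
   fun x hx => by rw [Equiv.Perm.inv_eq_iff_eq, ha.2 x hx]⟩

lemma inB_mem {N : ℕ} {a : Equiv.Perm ℤ} (ha : inB N a) {x : ℤ} : a x ∈ signedSet N ↔ x ∈ signedSet N := by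
  constructor
  · intro h
    by_contra hx
    rw [ha.2 x hx] at h
    exact hx h
  · intro h
    by_contra hx
    have h1 := (inB_inv ha).2 _ hx
    simp at h1
    rw [← h1] at hx
    exact hx h

lemma genB_iff {N : ℕ} {g : Equiv.Perm ℤ} (hg : g ∈ genB N) :
    ∃ i x, i ∈ signedSet N ∧ x ∈ signedSet N ∧ g = rfn i x := by
  have aux : ∀ i : ℤ, 1 ≤ i → i ≤ N → i ∈ signedSet N := fun i h1 h2 =>
    ⟨by omega, by rw [abs_of_pos (by omega)]; exact h2⟩
  rcases hg with ⟨i, j, h1, h2, h3, h4, h5, rfl⟩ | ⟨i, j, h1, h2, h3, h4, h5, rfl⟩ | ⟨i, h1, h2, rfl⟩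
  · exact ⟨i, j, aux i h1 h2, aux j h3 h4, by unfold rfn; rw [if_neg (by omega)]⟩
  · refine ⟨i, -j, aux i h1 h2, mem_signed_neg.2 (aux j h3 h4), ?_⟩
    unfold rfn; rw [if_neg (by omega), neg_neg]
  · exact ⟨i, -i, aux i h1 h2, mem_signed_neg.2 (aux i h1 h2), by unfold rfn; rw [if_pos rfl]⟩

lemma rfn_neg (i x : ℤ) (hi : i ≠ 0) (hx : x ≠ 0) : rfn (-i) (-x) = rfn i x := by
  ext z
  rw [rfn_apply hi hx, rfn_apply (by omega) (by omega)]
  split_ifs <;> omega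

lemma rfn_mem_genB {N : ℕ} {i x : ℤ} (hi : i ∈ signedSet N) (hx : x ∈ signedSet N) (h : x ≠ i) :
    rfn i x ∈ genB N := by
  have aux : ∀ i x : ℤ, i ∈ signedSet N → x ∈ signedSet N → x ≠ i → 0 < i → rfn i x ∈ genB N := by
    intro i x hi hx h hp
    have h1 := hi.2
    have h2 := hx.2
    have h3 := hx.1
    rw [abs_le] at h1 h2
    by_cases hxi : x = -i
    · right; right
      exact ⟨i, by omega, by omega, by unfold rfn; rw [if_pos hxi]⟩
    · rcases lt_or_gt_of_ne h3 with h4 | h4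
      · right; left
        exact ⟨i, -x, by omega, by omega, by omega, by omega, by omega, by
          unfold rfn; rw [if_neg hxi, neg_neg]⟩
      · left
        exact ⟨i, x, by omega, by omega, by omega, by omega, by omega, by
          unfold rfn; rw [if_neg hxi]⟩
  rcases lt_or_gt_of_ne hi.1 with h4 | h4
  · rw [← rfn_neg i x hi.1 hx.1]
    exact aux _ _ (mem_signed_neg.2 hi) (mem_signed_neg.2 hx) (by omega) (by omega)
  · exact aux _ _ hi hx h h4

lemma mem_Fx_rfn {N : ℕ} {i x : ℤ} (hi : i ≠ 0) (hx : x ≠ 0) {v : ℤ → ℚ} (hv : v ∈ Vs N)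
    (h : v i = v x) : v ∈ Fx N (rfn i x) := by
  refine ⟨hv, fun z => ?_⟩
  rw [rfn_apply hi hx]
  split_ifs with h1 h2 h3 h4
  · rw [h1, h]
  · rw [h2, h]
  · rw [h3, hv.1, hv.1, h]
  · rw [h4, hv.1, hv.1, h]
  · rfl

lemma Ln_rfn {N : ℕ} {i x : ℤ} (hi : i ≠ 0) (hx : x ≠ 0) : Ln N (rfn i x) ≤ 1 := by
  let φ : Vs N →ₗ[ℚ] ℚ :=
    { toFun := fun v => v.1 i - v.1 x
      map_add' := fun a b => by simp; ring
      map_smul' := fun c a => by simp; ring }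
  have h1 := φ.finrank_range_add_finrank_ker
  have h2 : Module.finrank ℚ (LinearMap.range φ) ≤ 1 := by
    simpa using Submodule.finrank_le (LinearMap.range φ)
  have h3 : Module.finrank ℚ (LinearMap.ker φ) ≤ dd N (rfn i x) := by
    let g : LinearMap.ker φ →ₗ[ℚ] Fx N (rfn i x) :=
      { toFun := fun v => ⟨v.1.1, mem_Fx_rfn hi hx v.1.2 (by
          have := v.2
          rw [LinearMap.mem_ker] at this
          exact sub_eq_zero.1 this)⟩
        map_add' := fun _ _ => rfl
        map_smul' := fun _ _ => rfl }
    apply LinearMap.finrank_le_finrank_of_injective (f := g)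
    intro a b hab
    ext z
    exact congrFun (congrArg Subtype.val hab) z
  have := Ln_add N (rfn i x)
  have h5 : Module.finrank ℚ (Vs N) = DD N := rfl
  omega

open Classical in
/-- signed indicator -/
noncomputable def sind (S : Set ℤ) (z : ℤ) : ℚ := (if z ∈ S then 1 else 0) - (if -z ∈ S then 1 else 0)

lemma sind_Vs {N : ℕ} {S : Set ℤ} (hS : S ⊆ signedSet N) : sind S ∈ Vs N := by
  refine ⟨fun x => by unfold sind; rw [neg_neg]; ring, fun x hx => ?_⟩
  have h1 : x ∉ S := fun h => hx (hS h)
  have h2 : -x ∉ S := fun h => hx (mem_signed_neg.1 (hS h))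
  simp [sind, h1, h2]

lemma sind_one {S : Set ℤ} {z : ℤ} (h : z ∈ S) (h' : -z ∉ S) : sind S z = 1 := by simp [sind, h, h']

lemma sind_zero {S : Set ℤ} {z : ℤ} (h : z ∉ S) (h' : -z ∉ S) : sind S z = 0 := by simp [sind, h, h']

lemma sind_pos {S : Set ℤ} {z : ℤ} (h : sind S z = 1) : z ∈ S := by
  unfold sind at h
  by_contra hz
  rw [if_neg hz] at h
  split_ifs at h <;> norm_num at h

lemma sind_Fx {N : ℕ} {S : Set ℤ} (hS : S ⊆ signedSet N) {τ : Equiv.Perm ℤ} (hτ : inB N τ)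
    (h : ∀ z, τ z ∈ S ↔ z ∈ S) : sind S ∈ Fx N τ :=
  ⟨sind_Vs hS, fun x => by
    have h2 : (-(τ x) ∈ S) = (-x ∈ S) := by rw [← hτ.1]; exact propext (h (-x))
    have h1 : (τ x ∈ S) = (x ∈ S) := propext (h x)
    unfold sind
    congr 1
    · by_cases hx : x ∈ S
      · rw [if_pos hx, if_pos (h1 ▸ hx)]
      · rw [if_neg hx, if_neg (h1 ▸ hx)]
    · by_cases hx : -x ∈ S
      · rw [if_pos hx, if_pos (h2 ▸ hx)]
      · rw [if_neg hx, if_neg (h2 ▸ hx)]⟩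

/-- general criterion for going down -/
lemma Ln_down {N : ℕ} {i x : ℤ} (hi : i ≠ 0) (hx : x ≠ 0) {w : Equiv.Perm ℤ}
    (h1 : ∀ v ∈ Fx N w, v i = v x) (h2 : ∃ v ∈ Fx N (rfn i x * w), v ∉ Fx N w) :
    Ln N (rfn i x * w) + 1 = Ln N w := by
  have h3 : Fx N w < Fx N (rfn i x * w) := by
    refine lt_of_le_of_ne ?_ ?_
    · intro v hv
      exact Fx_inf_le _ _ _ ⟨mem_Fx_rfn hi hx hv.1 (h1 v hv), hv⟩
    · intro h
      obtain ⟨v, hv, hv'⟩ := h2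
      rw [h] at hv'; exact hv' hv
  have h4 : dd N w < dd N (rfn i x * w) := Submodule.finrank_lt_finrank_of_lt h3
  have h5 := Ln_mul N (rfn i x) (rfn i x * w)
  rw [← mul_assoc, rfn_mul_self hi hx, one_mul] at h5
  have := Ln_rfn (N := N) hi hx
  have := Ln_add N w
  have := Ln_add N (rfn i x * w)
  omega

lemma Ln_fix {N : ℕ} {i : ℤ} (hi : i ∈ signedSet N) {τ : Equiv.Perm ℤ} (hτ : inB N τ) (h : τ i ≠ i) :
    Ln N (rfn i (τ i) * τ) + 1 = Ln N τ := by
  have hx := (inB_mem hτ).2 hi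
  apply Ln_down hi.1 hx.1
  · intro v hv; exact (hv.2 i).symm
  · have hB := inB_mul (inB_rfn hi hx) hτ
    have hsub : ({i} : Set ℤ) ⊆ signedSet N := by simpa using hi
    have hfix : (rfn i (τ i) * τ) i = i := by
      rw [Equiv.Perm.mul_apply, rfn_apply hi.1 hx.1]; simp [h]
    refine ⟨sind {i}, sind_Fx hsub hB ?_, ?_⟩
    · intro z
      simp only [Set.mem_singleton_iff]
      have := (Equiv.injective (rfn i (τ i) * τ)).eq_iff (a := z) (b := i)
      rwa [hfix] at this
    · intro hv
      have h1 := hv.2 i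
      have h2 : sind {i} i = 1 := sind_one (by simp) (by have := hi.1; simp; omega)
      rw [h2] at h1
      exact h (by simpa using sind_pos h1)

lemma lenB_aux (N : ℕ) (k : ℕ) : ∀ τ, inB N τ → Ln N τ = k →
    ∃ l : List (Equiv.Perm ℤ), l.length = k ∧ (∀ g ∈ l, g ∈ genB N) ∧ l.prod = τ := by
  induction k with
  | zero =>
    intro τ hτ h
    refine ⟨[], rfl, by simp, ?_⟩
    ext x
    by_contra hx
    have hx' : τ x ≠ x := fun h => hx (by simp [h])
    have hs : x ∈ signedSet N := by
      by_contra hs; exact hx' (hτ.2 x hs)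
    have := Ln_fix hs hτ hx'
    omega
  | succ k ih =>
    intro τ hτ h
    have : ∃ x, τ x ≠ x := by
      by_contra! hx
      have : τ = 1 := by ext x; simp [hx x]
      rw [this, Ln_one] at h; omega
    obtain ⟨x, hx⟩ := this
    have hs : x ∈ signedSet N := by
      by_contra hs; exact hx (hτ.2 x hs)
    have h1 := Ln_fix hs hτ hx
    have hs' := (inB_mem hτ).2 hs
    obtain ⟨l, hl, hl2, hl3⟩ := ih _ (inB_mul (inB_rfn hs hs') hτ) (by omega)
    refine ⟨rfn x (τ x) :: l, by simp [hl], ?_, ?_⟩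
    · intro g hg
      rcases List.mem_cons.1 hg with rfl | hg
      · exact rfn_mem_genB hs hs' hx
      · exact hl2 g hg
    · rw [List.prod_cons, hl3, ← mul_assoc, rfn_mul_self hs.1 hs'.1, one_mul]

lemma lenB_eq {N : ℕ} {τ : Equiv.Perm ℤ} (hτ : inB N τ) : lenB N τ = Ln N τ := by
  apply le_antisymm
  · exact Nat.sInf_le (lenB_aux N _ τ hτ rfl)
  · have hne : {k : ℕ | ∃ l : List (Equiv.Perm ℤ),
      l.length = k ∧ (∀ g ∈ l, g ∈ genB N) ∧ l.prod = τ}.Nonempty := ⟨_, lenB_aux N _ τ hτ rfl⟩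
    obtain ⟨l, hl, hl2, hl3⟩ := Nat.sInf_mem hne
    unfold lenB
    rw [← hl]
    clear hl hne hτ
    induction l generalizing τ with
    | nil => simp at hl3; rw [← hl3, Ln_one]; simp
    | cons g l ih =>
      have h1 := ih (fun g hg => hl2 g (by simp [hg])) rfl
      rw [List.prod_cons] at hl3
      rw [← hl3]
      obtain ⟨i, x, hi, hx, rfl⟩ := genB_iff (hl2 g (by simp))
      have := Ln_mul N (rfn i x) l.prod
      have := Ln_rfn (N := N) hi.1 hx.1
      simp; omega
def Iv (N : ℕ) (w : Equiv.Perm ℤ) : Set (Equiv.Perm ℤ) :=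
  {τ | inB N τ ∧ Ln N w = Ln N τ + Ln N (τ⁻¹ * w)}

lemma mem_Iv {N : ℕ} {w τ : Equiv.Perm ℤ} :
    τ ∈ Iv N w ↔ inB N τ ∧ Ln N w = Ln N τ + Ln N (τ⁻¹ * w) := Iff.rfl

lemma mem_Iv_of_le {N : ℕ} {w τ : Equiv.Perm ℤ} (hτ : inB N τ)
    (h : Ln N τ + Ln N (τ⁻¹ * w) ≤ Ln N w) : τ ∈ Iv N w := by
  refine ⟨hτ, le_antisymm ?_ h⟩
  have := Ln_mul N τ (τ⁻¹ * w)
  rwa [mul_inv_cancel_left] at this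

lemma finite_inB (N : ℕ) : {τ | inB N τ}.Finite := by
  have hs : (signedSet N).Finite := by
    apply (Set.finite_Icc (-(N:ℤ)) N).subset
    intro x hx
    exact abs_le.1 hx.2
  have : Finite (signedSet N) := hs
  have : Finite {x // x ∈ signedSet N} := hs
  have e : Equiv.Perm {x // x ∈ signedSet N} ≃
    {f : Equiv.Perm ℤ // ∀ a, ¬ (a ∈ signedSet N) → f a = a} := by
    classical exact Equiv.Perm.subtypeEquivSubtypePerm _
  have h2 : Finite {f : Equiv.Perm ℤ // ∀ a, ¬ (a ∈ signedSet N) → f a = a} :=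
    Finite.of_equiv _ e
  have h3 : {f : Equiv.Perm ℤ | ∀ a, ¬ (a ∈ signedSet N) → f a = a}.Finite := h2
  exact h3.subset fun f hf => hf.2

lemma finite_Iv (N : ℕ) (w : Equiv.Perm ℤ) : (Iv N w).Finite :=
  (finite_inB N).subset fun _ h => h.1

lemma Iv_inf {N : ℕ} {w τ : Equiv.Perm ℤ} (h : τ ∈ Iv N w) :
    Fx N τ ⊓ Fx N (τ⁻¹ * w) = Fx N w := by
  apply Submodule.eq_of_le_of_finrank_le
  · have := Fx_inf_le N τ (τ⁻¹ * w)
    rwa [mul_inv_cancel_left] at this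
  · have h1 := Submodule.finrank_sup_add_finrank_inf_eq (Fx N τ) (Fx N (τ⁻¹ * w))
    have h2 : Module.finrank ℚ ↥(Fx N τ ⊔ Fx N (τ⁻¹ * w)) ≤ DD N :=
      Submodule.finrank_mono (sup_le (Fx_le N _) (Fx_le N _))
    have := Ln_add N τ
    have := Ln_add N w
    have := Ln_add N (τ⁻¹ * w)
    have := h.2
    unfold dd at *
    omega

lemma Iv_Fx {N : ℕ} {w τ : Equiv.Perm ℤ} (h : τ ∈ Iv N w) : Fx N w ≤ Fx N τ := by
  rw [← Iv_inf h]; exact inf_le_left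

lemma Iv_fix {N : ℕ} {w τ : Equiv.Perm ℤ} (hw : inB N w) (h : τ ∈ Iv N w) {x : ℤ} (hx : w x = x) :
    τ x = x := by
  by_cases hs : x ∈ signedSet N
  · have hsub : ({x} : Set ℤ) ⊆ signedSet N := by simpa using hs
    have h1 : sind {x} ∈ Fx N w := by
      apply sind_Fx hsub hw
      intro z
      simp only [Set.mem_singleton_iff]
      have := (Equiv.injective w).eq_iff (a := z) (b := x)
      rwa [hx] at this
    have h2 := (Iv_Fx h h1).2 x
    have h3 : sind {x} x = 1 := sind_one (by simp) (by have := hs.1; simp; omega)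
    rw [h3] at h2
    simpa using sind_pos h2
  · exact h.1.2 x hs

/-- elements of the interval fixing `i` -/
lemma Iv_fixed {N : ℕ} {w : Equiv.Perm ℤ} (hw : inB N w) {i : ℤ} (hi : i ∈ signedSet N) :
    {τ | τ ∈ Iv N w ∧ τ i = i} = Iv N (rfn i (w i) * w) := by
  have hx := (inB_mem hw).2 hi
  by_cases hwi : w i = i
  · rw [hwi, rfn_self, one_mul]
    ext τ
    exact ⟨fun h => h.1, fun h => ⟨h, Iv_fix hw h hwi⟩⟩
  · have hd := Ln_fix hi hw hwi
    have hB := inB_mul (inB_rfn hi hx) hw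
    have hfix : (rfn i (w i) * w) i = i := by
      rw [Equiv.Perm.mul_apply, rfn_apply hi.1 hx.1]; simp [hwi]
    have hconj : rfn i (w i) * w = w * rfn i (w⁻¹ i) := by
      have hx' := (inB_mem (inB_inv hw)).2 hi
      ext z
      simp only [Equiv.Perm.mul_apply]
      rw [rfn_apply hi.1 hx.1, rfn_apply hi.1 hx'.1]
      have e1 : w z = i ↔ z = w⁻¹ i := by rw [Equiv.Perm.eq_inv_iff_eq]
      have e2 : w z = w i ↔ z = i := (Equiv.injective w).eq_iff
      have e3 : w z = - i ↔ z = - w⁻¹ i := by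
        rw [← (inB_inv hw).1, Equiv.Perm.eq_inv_iff_eq]
      have e4 : w z = - w i ↔ z = -i := by rw [← hw.1]; exact (Equiv.injective w).eq_iff
      simp only [e1, e2, e3, e4]
      have f0 : w⁻¹ i ≠ i := by
        intro h; rw [Equiv.Perm.inv_eq_iff_eq] at h; exact hwi h.symm
      have f1 : w (w⁻¹ i) = i := by simp
      have f2 : w (-w⁻¹ i) = -i := by rw [hw.1, f1]
      have f3 := hw.1 i
      generalize w⁻¹ i = j at *
      split_ifs <;> first | (exfalso; omega) | simp only [f1, f2, f3]
    ext τ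
    constructor
    · rintro ⟨h, hτ⟩
      apply mem_Iv_of_le h.1
      have hk : inB N (τ⁻¹ * w) := inB_mul (inB_inv h.1) hw
      have hk' := inB_inv hk
      have h3 : (τ⁻¹ * w)⁻¹ i = w⁻¹ i := by
        rw [mul_inv_rev, inv_inv, Equiv.Perm.mul_apply, hτ]
      have h4 : (τ⁻¹ * w)⁻¹ i ≠ i := by
        rw [h3]; intro h; rw [Equiv.Perm.inv_eq_iff_eq] at h; exact hwi h.symm
      have h5 := Ln_fix hi hk' h4
      have hx' := (inB_mem (inB_inv hw)).2 hi
      have h6 : (rfn i ((τ⁻¹ * w)⁻¹ i) * (τ⁻¹ * w)⁻¹) = (τ⁻¹ * (rfn i (w i) * w))⁻¹ := by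
        rw [h3, hconj, ← mul_assoc, mul_inv_rev (τ⁻¹ * w), rfn_inv hi.1 hx'.1]
      rw [h6, Ln_inv, Ln_inv] at h5
      have := h.2
      omega
    · intro h
      refine ⟨?_, Iv_fix hB h hfix⟩
      apply mem_Iv_of_le h.1
      have hx' := (inB_mem (inB_inv hw)).2 hi
      have h1 : τ⁻¹ * w = (τ⁻¹ * (rfn i (w i) * w)) * rfn i (w⁻¹ i) := by
        rw [hconj, mul_assoc, mul_assoc, rfn_mul_self hi.1 hx'.1, mul_one]
      have h2 := Ln_mul N (τ⁻¹ * (rfn i (w i) * w)) (rfn i (w⁻¹ i))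
      rw [← h1] at h2
      have := Ln_rfn (N := N) hi.1 hx'.1
      have := h.2
      omega

/-- elements of the interval sending `i` to `x` -/
lemma Iv_send {N : ℕ} {w : Equiv.Perm ℤ} {i x : ℤ} (hi : i ∈ signedSet N)
    (hx : x ∈ signedSet N) (hne : x ≠ i) (hd : Ln N (rfn i x * w) + 1 = Ln N w) :
    {τ | τ ∈ Iv N w ∧ τ i = x} = (fun τ => rfn i x * τ) '' {τ | τ ∈ Iv N (rfn i x * w) ∧ τ i = i} := by
  have hB := inB_rfn hi hx
  have hinv : ∀ τ : Equiv.Perm ℤ, rfn i x * (rfn i x * τ) = τ := fun τ => by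
    rw [← mul_assoc, rfn_mul_self hi.1 hx.1, one_mul]
  have ex : rfn i x x = i := by rw [rfn_apply hi.1 hx.1]; simp [hne]
  have ei : rfn i x i = x := by rw [rfn_apply hi.1 hx.1]; simp
  ext τ
  constructor
  · rintro ⟨h, hτ⟩
    refine ⟨rfn i x * τ, ⟨mem_Iv_of_le (inB_mul hB h.1) ?_, ?_⟩, hinv τ⟩
    · have h1 := Ln_fix hi h.1 (by rw [hτ]; exact hne)
      rw [hτ] at h1
      rw [mul_inv_rev, rfn_inv hi.1 hx.1, mul_assoc, hinv]
      have := h.2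
      omega
    · rw [Equiv.Perm.mul_apply, hτ, ex]
  · rintro ⟨σ, ⟨h, hσ⟩, rfl⟩
    refine ⟨mem_Iv_of_le (inB_mul hB h.1) ?_, ?_⟩
    · have h1 := Ln_mul N (rfn i x) σ
      have := Ln_rfn (N := N) hi.1 hx.1
      simp only
      rw [mul_inv_rev, rfn_inv hi.1 hx.1, mul_assoc]
      have := h.2
      omega
    · simp only [Equiv.Perm.mul_apply]; rw [hσ, ei]

lemma card_send {N : ℕ} {w : Equiv.Perm ℤ} (hw : inB N w) {i x : ℤ} (hi : i ∈ signedSet N)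
    (hx : x ∈ signedSet N) (hne : x ≠ i) (hd : Ln N (rfn i x * w) + 1 = Ln N w) :
    {τ | τ ∈ Iv N w ∧ τ i = x}.ncard =
      (Iv N (rfn i ((rfn i x * w) i) * (rfn i x * w))).ncard := by
  rw [Iv_send hi hx hne hd, Set.ncard_image_of_injective _ (mul_right_injective _),
    Iv_fixed (inB_mul (inB_rfn hi hx) hw) hi]

/-- additivity of length on disjoint supports -/
lemma Ln_disj {N : ℕ} {S : Set ℤ} (hS : ∀ x, -x ∈ S ↔ x ∈ S) {a b : Equiv.Perm ℤ}
    (ha : ∀ x, x ∉ S → a x = x) (hb : ∀ x, x ∈ S → b x = x) :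
    Ln N (a * b) = Ln N a + Ln N b := by
  have haS : ∀ x, a x ∈ S ↔ x ∈ S := by
    intro x
    constructor
    · intro h; by_contra hx; rw [ha x hx] at h; exact hx h
    · intro h; by_contra hx
      have := a.injective (ha _ hx)
      rw [this] at hx; exact hx h
  have hbS : ∀ x, b x ∈ S ↔ x ∈ S := by
    intro x
    constructor
    · intro h
      have := b.injective (hb _ h)
      rwa [this] at h
    · intro h; rwa [hb x h]
  have h1 : Fx N a ⊓ Fx N b = Fx N (a * b) := by
    apply le_antisymm (Fx_inf_le N a b)
    intro v hv
    refine ⟨⟨hv.1, fun x => ?_⟩, ⟨hv.1, fun x => ?_⟩⟩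
    · by_cases hx : x ∈ S
      · have := hv.2 x
        rwa [Equiv.Perm.mul_apply, hb x hx] at this
      · rw [ha x hx]
    · by_cases hx : x ∈ S
      · rw [hb x hx]
      · have := hv.2 x
        rwa [Equiv.Perm.mul_apply, ha (b x) (by rwa [hbS])] at this
  have h2 : Fx N a ⊔ Fx N b = Vs N := by
    classical
    apply le_antisymm (sup_le (Fx_le N a) (Fx_le N b))
    intro v hv
    rw [Submodule.mem_sup]
    refine ⟨fun x => if x ∈ S then 0 else v x, ⟨⟨?_, ?_⟩, ?_⟩, fun x => if x ∈ S then v x else 0,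
      ⟨⟨?_, ?_⟩, ?_⟩, ?_⟩
    · intro x
      by_cases hx : x ∈ S
      · simp [hx, hS]
      · simp [hx, hS, hv.1]
    · intro x hx
      simp [hv.2 x hx]
    · intro x
      by_cases hx : x ∈ S
      · simp [hx, haS]
      · simp [hx, ha]
    · intro x
      by_cases hx : x ∈ S
      · simp [hx, hS, hv.1]
      · simp [hx, hS]
    · intro x hx
      simp [hv.2 x hx]
    · intro x
      by_cases hx : x ∈ S
      · simp [hx, hb]
      · simp [hx, hbS]
    · ext x
      by_cases hx : x ∈ S <;> simp [hx]
  have h3 := Submodule.finrank_sup_add_finrank_inf_eq (Fx N a) (Fx N b)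
  rw [h1, h2] at h3
  have := Ln_add N a
  have := Ln_add N b
  have := Ln_add N (a * b)
  unfold dd DD at *
  omega

lemma card_mul {N : ℕ} {S : Set ℤ} (hS : ∀ x, -x ∈ S ↔ x ∈ S) {w₁ w₂ : Equiv.Perm ℤ}
    (hw₁ : inB N w₁) (hw₂ : inB N w₂)
    (h₁ : ∀ x, x ∉ S → w₁ x = x) (h₂ : ∀ x, x ∈ S → w₂ x = x) :
    {τ | τ ∈ Iv N (w₁ * w₂) ∧ ∀ x, τ x ∈ S ↔ x ∈ S}.ncard = (Iv N w₁).ncard * (Iv N w₂).ncard := by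
  classical
  have inv1 : ∀ a : Equiv.Perm ℤ, (∀ x, x ∉ S → a x = x) → (∀ x, x ∉ S → a⁻¹ x = x) :=
    fun a ha x hx => by rw [Equiv.Perm.inv_eq_iff_eq, ha x hx]
  have inv2 : ∀ a : Equiv.Perm ℤ, (∀ x, x ∈ S → a x = x) → (∀ x, x ∈ S → a⁻¹ x = x) :=
    fun a ha x hx => by rw [Equiv.Perm.inv_eq_iff_eq, ha x hx]
  have pres1 : ∀ a : Equiv.Perm ℤ, (∀ x, x ∉ S → a x = x) → ∀ x, a x ∈ S ↔ x ∈ S := by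
    intro a ha x
    constructor
    · intro h; by_contra hx; rw [ha x hx] at h; exact hx h
    · intro h; by_contra hx
      have := a.injective (ha _ hx)
      rw [this] at hx; exact hx h
  have pres2 : ∀ a : Equiv.Perm ℤ, (∀ x, x ∈ S → a x = x) → ∀ x, a x ∈ S ↔ x ∈ S := by
    intro a ha x
    constructor
    · intro h
      have := a.injective (ha _ h)
      rwa [this] at h
    · intro h; rwa [ha x h]
  have comm : ∀ a b : Equiv.Perm ℤ, (∀ x, x ∉ S → a x = x) → (∀ x, x ∈ S → b x = x) →
      a * b = b * a := by
    intro a b ha hb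
    ext x
    simp only [Equiv.Perm.mul_apply]
    by_cases hx : x ∈ S
    · rw [hb x hx, hb _ ((pres1 a ha x).2 hx)]
    · rw [ha x hx, ha _ (fun h => hx ((pres2 b hb x).1 h))]
  have mulfix1 : ∀ a b : Equiv.Perm ℤ, (∀ x, x ∉ S → a x = x) → (∀ x, x ∉ S → b x = x) →
      (∀ x, x ∉ S → (a * b) x = x) := fun a b ha hb x hx => by
    rw [Equiv.Perm.mul_apply, hb x hx, ha x hx]
  have mulfix2 : ∀ a b : Equiv.Perm ℤ, (∀ x, x ∈ S → a x = x) → (∀ x, x ∈ S → b x = x) →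
      (∀ x, x ∈ S → (a * b) x = x) := fun a b ha hb x hx => by
    rw [Equiv.Perm.mul_apply, hb x hx, ha x hx]
  have key : ∀ a b : Equiv.Perm ℤ, (∀ x, x ∉ S → a x = x) → (∀ x, x ∈ S → b x = x) →
      (a * b)⁻¹ * (w₁ * w₂) = (a⁻¹ * w₁) * (b⁻¹ * w₂) := by
    intro a b ha hb
    rw [mul_inv_rev, mul_assoc, ← mul_assoc a⁻¹, ← mul_assoc, ← comm _ b⁻¹ (mulfix1 _ _ (inv1 a ha) h₁) (inv2 b hb), mul_assoc]
  have keyL : ∀ a b : Equiv.Perm ℤ, (∀ x, x ∉ S → a x = x) → (∀ x, x ∈ S → b x = x) →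
      Ln N ((a * b)⁻¹ * (w₁ * w₂)) = Ln N (a⁻¹ * w₁) + Ln N (b⁻¹ * w₂) := by
    intro a b ha hb
    rw [key a b ha hb, Ln_disj hS (mulfix1 _ _ (inv1 a ha) h₁) (mulfix2 _ _ (inv2 b hb) h₂)]
  have hL := Ln_disj (N := N) hS h₁ h₂
  rw [← Set.ncard_prod]
  have fix1 : ∀ a ∈ Iv N w₁, ∀ x, x ∉ S → a x = x := fun a ha x hx => Iv_fix hw₁ ha (h₁ x hx)
  have fix2 : ∀ a ∈ Iv N w₂, ∀ x, x ∈ S → a x = x := fun a ha x hx => Iv_fix hw₂ ha (h₂ x hx)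
  have himg : {τ | τ ∈ Iv N (w₁ * w₂) ∧ ∀ x, τ x ∈ S ↔ x ∈ S} =
      (fun ab : Equiv.Perm ℤ × Equiv.Perm ℤ => ab.1 * ab.2) '' (Iv N w₁ ×ˢ Iv N w₂) := by
    ext τ
    constructor
    · rintro ⟨h, hτ⟩
      let a : Equiv.Perm ℤ := Equiv.Perm.ofSubtype (τ.subtypePerm (p := fun x => x ∈ S) hτ)
      let b : Equiv.Perm ℤ := a⁻¹ * τ
      have a1 : ∀ x, x ∈ S → a x = τ x := fun x hx => by
        simp only [a]
        rw [Equiv.Perm.ofSubtype_apply_of_mem _ hx]; rfl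
      have a2 : ∀ x, x ∉ S → a x = x := fun x hx => by
        simp only [a]
        rw [Equiv.Perm.ofSubtype_apply_of_not_mem _ hx]
      have b2 : ∀ x, x ∈ S → b x = x := fun x hx => by
        simp only [b, Equiv.Perm.mul_apply]
        rw [Equiv.Perm.inv_eq_iff_eq, a1 x hx]
      have hab : a * b = τ := by simp only [b]; rw [mul_inv_cancel_left]
      have hBa : inB N a := by
        constructor
        · intro x
          by_cases hx : x ∈ S
          · rw [a1 x hx, a1 _ ((hS x).2 hx), h.1.1]
          · rw [a2 x hx, a2 _ (fun h => hx ((hS x).1 h))]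
        · intro x hx
          by_cases hx' : x ∈ S
          · rw [a1 x hx', h.1.2 x hx]
          · rw [a2 x hx']
      have hBb : inB N b := by
        exact inB_mul (inB_inv hBa) h.1
      have e1 := h.2
      rw [← hab, keyL a b a2 b2, Ln_disj hS a2 b2, hL] at e1
      have e2 := Ln_mul N a (a⁻¹ * w₁)
      have e3 := Ln_mul N b (b⁻¹ * w₂)
      rw [mul_inv_cancel_left] at e2 e3
      have m1 : a ∈ Iv N w₁ := ⟨hBa, by omega⟩
      have m2 : b ∈ Iv N w₂ := ⟨hBb, by omega⟩
      exact ⟨(a, b), ⟨m1, m2⟩, hab⟩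
    · rintro ⟨⟨a, b⟩, ⟨ha, hb⟩, rfl⟩
      have a2 := fix1 a ha
      have b2 := fix2 b hb
      refine ⟨⟨inB_mul ha.1 hb.1, ?_⟩, fun x => ?_⟩
      · simp only
        rw [keyL a b a2 b2, Ln_disj hS a2 b2, hL, ha.2, hb.2]; ring
      · simp only [Equiv.Perm.mul_apply]
        rw [pres1 a a2, pres2 b b2]
  rw [himg, Set.InjOn.ncard_image]
  rintro ⟨a, b⟩ ⟨ha, hb⟩ ⟨a', b'⟩ ⟨ha', hb'⟩ h
  simp only at h ha hb ha' hb'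
  have e : a = a' := by
    ext x
    by_cases hx : x ∈ S
    · have := congrArg (fun f : Equiv.Perm ℤ => f x) h
      simp only [Equiv.Perm.mul_apply] at this
      rw [fix2 b hb x hx, fix2 b' hb' x hx] at this
      simpa using this
    · rw [fix1 a ha x hx, fix1 a' ha' x hx]
  subst e
  have := mul_left_cancel h
  rw [this]
def ng (l : List ℤ) : List ℤ := l.map (fun x => -x)

lemma mem_ng {l : List ℤ} {x : ℤ} : x ∈ ng l ↔ -x ∈ l := by
  unfold ng
  rw [List.mem_map]
  constructor
  · rintro ⟨a, ha, rfl⟩; simpa using ha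
  · intro h; exact ⟨-x, h, by simp⟩

def bal (l : List ℤ) : Equiv.Perm ℤ := (l ++ ng l).formPerm
def par (l : List ℤ) : Equiv.Perm ℤ := l.formPerm * (ng l).formPerm

lemma fp_split (i y : ℤ) (a B : List ℤ) (h : (i :: a ++ y :: B).Nodup) :
    Equiv.swap i y * (i :: a ++ y :: B).formPerm = (i :: a).formPerm * (y :: B).formPerm := by
  induction a generalizing i with
  | nil => simp
  | cons c a ih =>
    have ih' := ih c (by simp at h ⊢; tauto)
    have h1 : (c :: a ++ y :: B).formPerm = Equiv.swap c y * ((c :: a).formPerm * (y :: B).formPerm) := by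
      rw [← ih', ← mul_assoc, Equiv.swap_mul_self, one_mul]
    have hic : i ≠ c := by rintro rfl; simp at h
    have hiy : i ≠ y := by rintro rfl; simp at h
    have hcy : c ≠ y := by rintro rfl; simp at h
    have h2 : (i :: c :: a ++ y :: B).formPerm = Equiv.swap i c * (c :: a ++ y :: B).formPerm := by
      simp
    have h3 : Equiv.swap i y * (Equiv.swap i c * Equiv.swap c y) = Equiv.swap i c := by
      ext z
      simp only [Equiv.Perm.mul_apply, Equiv.swap_apply_def]
      split_ifs <;> omega
    rw [h2, h1, List.formPerm_cons_cons, ← mul_assoc (Equiv.swap i c), ← mul_assoc, h3, mul_assoc]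

lemma fp_rot (a b : List ℤ) (h : (a ++ b).Nodup) : (a ++ b).formPerm = (b ++ a).formPerm :=
  List.formPerm_eq_of_isRotated h List.isRotated_append

lemma fp_comm (a b : List ℤ) (h : ∀ x ∈ a, x ∉ b) :
    a.formPerm * b.formPerm = b.formPerm * a.formPerm := by
  apply Equiv.Perm.Disjoint.commute
  intro x
  by_cases hx : x ∈ a
  · right; exact List.formPerm_apply_of_notMem (h x hx)
  · left; exact List.formPerm_apply_of_notMem hx

lemma swap_fp (i j : ℤ) : Equiv.swap i j = [i, j].formPerm := by simp

lemma X1 (i y i' y' : ℤ) (a b a' b' : List ℤ)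
    (h : ((i :: a ++ y :: b) ++ (i' :: a' ++ y' :: b')).Nodup) :
    (Equiv.swap i y * Equiv.swap i' y') * ((i :: a ++ y :: b) ++ (i' :: a' ++ y' :: b')).formPerm =
      ((i :: a).formPerm * (i' :: a').formPerm) * (y :: b ++ y' :: b').formPerm := by
  have c1 : Equiv.swap i y * Equiv.swap i' y' = Equiv.swap i' y' * Equiv.swap i y := by
    rw [swap_fp, swap_fp]; apply fp_comm; grind
  have c2 : Equiv.swap i' y' * (i :: a).formPerm = (i :: a).formPerm * Equiv.swap i' y' := by
    rw [swap_fp]; apply fp_comm; grind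
  have e1 := fp_split i y a (b ++ (i' :: a' ++ y' :: b')) (by simpa using h)
  have r1 : (y :: b ++ (i' :: a' ++ y' :: b')).formPerm = (i' :: a' ++ y' :: (b' ++ y :: b)).formPerm := by
    rw [fp_rot _ _ (by grind)]; simp
  have e2 := fp_split i' y' a' (b' ++ y :: b) (by grind)
  have r2 : (y' :: (b' ++ y :: b)).formPerm = (y :: b ++ y' :: b').formPerm := by
    rw [fp_rot (y :: b) (y' :: b') (by grind)]; simp
  have l1 : (i :: a ++ y :: b) ++ (i' :: a' ++ y' :: b') = i :: a ++ y :: (b ++ (i' :: a' ++ y' :: b')) := by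
    simp
  have l2 : y :: (b ++ (i' :: a' ++ y' :: b')) = y :: b ++ (i' :: a' ++ y' :: b') := by simp
  rw [l1, c1, mul_assoc, e1, ← mul_assoc, c2, mul_assoc, l2, r1, e2, r2, mul_assoc]

lemma X2 (i y i' y' : ℤ) (a b a' b' : List ℤ)
    (h : ((i :: a ++ y :: b) ++ (i' :: a' ++ y' :: b')).Nodup) :
    (Equiv.swap i y' * Equiv.swap i' y) * ((i :: a ++ y :: b) ++ (i' :: a' ++ y' :: b')).formPerm =
      (i :: a ++ i' :: a').formPerm * ((y :: b).formPerm * (y' :: b').formPerm) := by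
  have c1 : Equiv.swap i y' * Equiv.swap i' y = Equiv.swap i' y * Equiv.swap i y' := by
    rw [swap_fp, swap_fp]; apply fp_comm; grind
  have e1 := fp_split i y' (a ++ y :: b ++ i' :: a') b' (by simpa using h)
  have l1 : (i :: a ++ y :: b) ++ (i' :: a' ++ y' :: b') = i :: (a ++ y :: b ++ i' :: a') ++ y' :: b' := by
    simp
  have r1 : (i :: (a ++ y :: b ++ i' :: a')).formPerm = (i' :: (a' ++ i :: a) ++ y :: b).formPerm := by
    have : i :: (a ++ y :: b ++ i' :: a') = (i :: a ++ y :: b) ++ (i' :: a') := by simp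
    rw [this, fp_rot _ _ (by grind)]; simp
  have e2 := fp_split i' y (a' ++ i :: a) b (by grind)
  have r2 : (i' :: (a' ++ i :: a)).formPerm = (i :: a ++ i' :: a').formPerm := by
    rw [fp_rot (i :: a) (i' :: a') (by grind)]; simp
  rw [l1, c1, mul_assoc, e1, ← mul_assoc, r1, e2, r2, mul_assoc]

lemma X4 (i y i' y' : ℤ) (a b a' b' : List ℤ)
    (h : ((i :: a ++ y :: b) ++ (i' :: a' ++ y' :: b')).Nodup) :
    (Equiv.swap i y * Equiv.swap i' y') * ((i :: a ++ y :: b).formPerm * (i' :: a' ++ y' :: b').formPerm) =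
      ((i :: a).formPerm * (i' :: a').formPerm) * ((y :: b).formPerm * (y' :: b').formPerm) := by
  have c2 : Equiv.swap i' y' * (i :: a ++ y :: b).formPerm = (i :: a ++ y :: b).formPerm * Equiv.swap i' y' := by
    rw [swap_fp]; apply fp_comm; grind
  have c3 : (y :: b).formPerm * (i' :: a').formPerm = (i' :: a').formPerm * (y :: b).formPerm := by
    apply fp_comm; grind
  have e1 := fp_split i y a b (by grind)
  have e2 := fp_split i' y' a' b' (by grind)
  rw [mul_assoc, ← mul_assoc (Equiv.swap i' y'), c2, mul_assoc, ← mul_assoc, e1, e2, mul_assoc,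
    ← mul_assoc (y :: b).formPerm, c3]
  simp only [mul_assoc]

def Good (N : ℕ) (l : List ℤ) : Prop :=
  l.Nodup ∧ (∀ x ∈ l, -x ∉ l) ∧ ∀ x ∈ l, x ∈ signedSet N

lemma Good.sub {N : ℕ} {l l' : List ℤ} (h : Good N l) (hs : l'.Sublist l) : Good N l' :=
  ⟨h.1.sublist hs, fun x hx hx' => h.2.1 x (hs.subset hx) (hs.subset hx'),
    fun x hx => h.2.2 x (hs.subset hx)⟩

lemma ng_nodup {l : List ℤ} (h : l.Nodup) : (ng l).Nodup :=
  h.map neg_injective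

lemma Good.nd {N : ℕ} {l : List ℤ} (h : Good N l) : (l ++ ng l).Nodup := by
  rw [List.nodup_append]
  refine ⟨h.1, ng_nodup h.1, ?_⟩
  rintro x hx y hy rfl
  exact h.2.1 x hx (mem_ng.1 hy)

lemma ng_cons (i : ℤ) (a : List ℤ) : ng (i :: a) = -i :: ng a := rfl
lemma ng_append (a b : List ℤ) : ng (a ++ b) = ng a ++ ng b := by simp [ng]

lemma Good.ne_neg {N : ℕ} {i y : ℤ} {a b : List ℤ} (h : Good N (i :: (a ++ y :: b))) :
    y ≠ i ∧ y ≠ -i := by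
  constructor
  · rintro rfl
    have := h.1
    simp at this
  · rintro rfl
    exact h.2.1 i (by simp) (by simp)

lemma Lb1 {N : ℕ} {i y : ℤ} {a b : List ℤ} (h : Good N (i :: (a ++ y :: b))) :
    rfn i y * bal (i :: (a ++ y :: b)) = par (i :: a) * bal (y :: b) := by
  have := X1 i y (-i) (-y) a b (ng a) (ng b) (by simpa [ng] using h.nd)
  unfold rfn
  rw [if_neg h.ne_neg.2]
  simpa [bal, par, ng] using this

lemma Lb2 {N : ℕ} {i y : ℤ} {a b : List ℤ} (h : Good N (i :: (a ++ y :: b))) :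
    rfn i (-y) * bal (i :: (a ++ y :: b)) = bal (i :: a) * par (y :: b) := by
  have := X2 i y (-i) (-y) a b (ng a) (ng b) (by simpa [ng] using h.nd)
  unfold rfn
  rw [if_neg (fun hh => h.ne_neg.1 (neg_injective hh)), neg_neg]
  simpa [bal, par, ng] using this

lemma Lb3 {N : ℕ} {i : ℤ} {a : List ℤ} (h : Good N (i :: a)) :
    rfn i (-i) * bal (i :: a) = par (i :: a) := by
  have := fp_split i (-i) a (ng a) (by simpa [ng] using h.nd)
  unfold rfn
  rw [if_pos rfl]
  simpa [bal, par, ng] using this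

lemma Lp1 {N : ℕ} {i y : ℤ} {a b : List ℤ} (h : Good N (i :: (a ++ y :: b))) :
    rfn i y * par (i :: (a ++ y :: b)) = par (i :: a) * par (y :: b) := by
  have := X4 i y (-i) (-y) a b (ng a) (ng b) (by simpa [ng] using h.nd)
  unfold rfn
  rw [if_neg h.ne_neg.2]
  simpa [bal, par, ng] using this

lemma par_nil : par [] = 1 := by simp [par, ng]
lemma bal_nil : bal [] = 1 := by simp [bal, ng]
lemma par_single (i : ℤ) : par [i] = 1 := by simp [par, ng]

lemma par_head {N : ℕ} {i c : ℤ} {a : List ℤ} (h : Good N (i :: c :: a)) : par (i :: c :: a) i = c := by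
  unfold par
  rw [Equiv.Perm.mul_apply, List.formPerm_apply_of_notMem (l := ng (i :: c :: a)) (x := i) (by
    rw [mem_ng]; exact h.2.1 i (by simp)), List.formPerm_apply_head _ _ _ h.1]

lemma bal_head {N : ℕ} {i c : ℤ} {a : List ℤ} (h : Good N (i :: c :: a)) : bal (i :: c :: a) i = c := by
  have := h.nd
  unfold bal
  simp only [List.cons_append] at this ⊢
  rw [List.formPerm_apply_head _ _ _ this]

lemma R1 {N : ℕ} {i : ℤ} {a : List ℤ} (h : Good N (i :: a)) :
    rfn i (par (i :: a) i) * par (i :: a) = par a := by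
  cases a with
  | nil => rw [par_single, par_nil]; simp [rfn_self]
  | cons c a =>
    rw [par_head h]
    have := Lp1 (a := []) h
    simpa [par_single] using this

lemma R2 {N : ℕ} {i : ℤ} {a : List ℤ} (h : Good N (i :: a)) :
    rfn i (bal (i :: a) i) * bal (i :: a) = bal a := by
  cases a with
  | nil =>
    have e : bal [i] i = -i := by simp [bal, ng]
    rw [e, Lb3 h, par_single, bal_nil]
  | cons c a =>
    rw [bal_head h]
    have := Lb1 (a := []) h
    simpa [par_single] using this

lemma par_fix {l : List ℤ} {x : ℤ} (h : x ∉ l) (h' : -x ∉ l) : par l x = x := by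
  unfold par
  rw [Equiv.Perm.mul_apply, List.formPerm_apply_of_notMem (l := ng l) (x := x) (by rwa [mem_ng]),
    List.formPerm_apply_of_notMem h]

lemma bal_fix {l : List ℤ} {x : ℤ} (h : x ∉ l) (h' : -x ∉ l) : bal l x = x := by
  unfold bal
  rw [List.formPerm_apply_of_notMem]
  simp [mem_ng, h, h']

lemma fp_map (l : List ℤ) (z : ℤ) : (ng l).formPerm (-z) = -(l.formPerm z) := by
  induction l generalizing z with
  | nil => simp [ng]
  | cons i l ih =>
    cases l with
    | nil => simp [ng]
    | cons c l =>
      simp only [ng_cons, List.formPerm_cons_cons, Equiv.Perm.mul_apply] at ih ⊢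
      rw [ih]
      simp only [Equiv.swap_apply_def]
      split_ifs <;> omega

lemma ng_ng (l : List ℤ) : ng (ng l) = l := by simp [ng]

lemma inB_par {N : ℕ} {l : List ℤ} (h : Good N l) : inB N (par l) := by
  constructor
  · intro x
    unfold par
    rw [fp_comm]
    · simp only [Equiv.Perm.mul_apply]
      have e : l.formPerm (-x) = -((ng l).formPerm x) := by
        have := fp_map (ng l) x
        rwa [ng_ng] at this
      rw [e, fp_map]
      rw [← Equiv.Perm.mul_apply, ← Equiv.Perm.mul_apply, fp_comm]
      intro y hy hy'
      exact h.2.1 y hy (mem_ng.1 hy')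
    · intro y hy hy'
      exact h.2.1 y hy (mem_ng.1 hy')
  · intro x hx
    exact par_fix (fun hh => hx (h.2.2 x hh)) (fun hh => hx (mem_signed_neg.1 (h.2.2 _ hh)))

lemma inB_bal {N : ℕ} {l : List ℤ} (h : Good N l) : inB N (bal l) := by
  constructor
  · intro x
    unfold bal
    have := fp_map (l ++ ng l) x
    rw [ng_append, ng_ng, ← fp_rot _ _ h.nd] at this
    exact this
  · intro x hx
    exact bal_fix (fun hh => hx (h.2.2 x hh)) (fun hh => hx (mem_signed_neg.1 (h.2.2 _ hh)))

lemma vinv_zpow {v : ℤ → ℚ} {f : Equiv.Perm ℤ} (h : ∀ x, v (f x) = v x) (m : ℤ) (x : ℤ) :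
    v ((f ^ m) x) = v x := by
  induction m using Int.induction_on with
  | zero => simp
  | succ n ih => rw [add_comm, zpow_add, zpow_one, Equiv.Perm.mul_apply, h, ih]
  | pred n ih =>
    rw [← h, ← Equiv.Perm.mul_apply, ← zpow_one_add, add_comm, sub_add_cancel, ih]

lemma Fx_bal {N : ℕ} {l : List ℤ} (h : Good N l) {v : ℤ → ℚ} (hv : ∀ x, v (-x) = - v x)
   (hv' : ∀ z, z ∈ l ∨ -z ∈ l → v (bal l z) = v z) {x : ℤ} (hx : x ∈ l) : v x = 0 := by
  have hf : ∀ z, v (bal l z) = v z := by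
    intro z
    by_cases hz : z ∈ l ∨ -z ∈ l
    · exact hv' z hz
    · push Not at hz
      rw [bal_fix hz.1 hz.2]
  have h1 := h.nd.isCycleOn_formPerm
  obtain ⟨m, hm⟩ := h1.2 (x := x) (y := -x) (by simp [hx]) (by simp [mem_ng, hx])
  have h2 := vinv_zpow (f := (l ++ ng l).formPerm) hf m x
  rw [hm, hv] at h2
  linarith

lemma Fx_par {N : ℕ} {l : List ℤ} (h : Good N l) {v : ℤ → ℚ} (hv : v ∈ Fx N (par l)) {x y : ℤ} (hx : x ∈ l)
    (hy : y ∈ l) : v x = v y := by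
  have h0 : ∀ z, v (l.formPerm z) = v z := by
    intro z
    by_cases hz : z ∈ l
    · have := hv.2 z
      unfold par at this
      rwa [Equiv.Perm.mul_apply, List.formPerm_apply_of_notMem (l := ng l) (x := z) (by
        rw [mem_ng]; exact h.2.1 z hz)] at this
    · rw [List.formPerm_apply_of_notMem hz]
  have h1 := h.1.isCycleOn_formPerm
  obtain ⟨m, hm⟩ := h1.2 (x := x) (y := y) (by simpa using hx) (by simpa using hy)
  have h2 := vinv_zpow h0 m x
  rw [hm] at h2
  exact h2.symm

lemma sind_par {N : ℕ} {l : List ℤ} (h : Good N l) {u : Equiv.Perm ℤ} (hu : inB N u)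
    (hfix : ∀ x ∈ l, u x = x) : sind {x | x ∈ l} ∈ Fx N (par l * u) := by
  have hsub : {x | x ∈ l} ⊆ signedSet N := fun x hx => h.2.2 x hx
  refine sind_Fx hsub (inB_mul (inB_par h) hu) ?_
  intro z
  show par l (u z) ∈ l ↔ z ∈ l
  have e1 : u z ∈ l ↔ z ∈ l := by
    constructor
    · intro hz
      have := u.injective (hfix _ hz)
      rwa [this] at hz
    · intro hz; rwa [hfix z hz]
  rw [← e1]
  generalize u z = z
  unfold par
  rw [Equiv.Perm.mul_apply, List.formPerm_mem_iff_mem]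
  constructor
  · intro hz
    by_contra hz'
    by_cases h2 : z ∈ ng l
    · have := (List.formPerm_mem_iff_mem (l := ng l)).2 h2
      exact h.2.1 _ hz (mem_ng.1 this)
    · rw [List.formPerm_apply_of_notMem h2] at hz; exact hz' hz
  · intro hz
    rwa [List.formPerm_apply_of_notMem (l := ng l) (x := z)]
    rw [mem_ng]; exact h.2.1 z hz
open Finset in
lemma catalan_cb (m : ℕ) : Nat.centralBinom (m + 1) =
    2 * ∑ k ∈ range (m + 1), catalan k * Nat.centralBinom (m - k) := by
  have h1 : ∀ n, Nat.centralBinom n = (n + 1) * catalan n := fun n => (succ_mul_catalan_eq_centralBinom n).symm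
  have h2 : catalan (m + 1) = ∑ k ∈ range (m + 1), catalan k * catalan (m - k) := by
    rw [catalan_succ', Finset.Nat.sum_antidiagonal_eq_sum_range_succ (fun a b => catalan a * catalan b)]
  have h3 : ∑ k ∈ range (m + 1), catalan k * Nat.centralBinom (m - k) =
      ∑ k ∈ range (m + 1), (m - k + 1) * (catalan k * catalan (m - k)) := by
    apply sum_congr rfl
    intro k hk
    rw [h1 (m - k)]; ring
  have h4 : ∑ k ∈ range (m + 1), (m - k + 1) * (catalan k * catalan (m - k)) =
      ∑ k ∈ range (m + 1), (k + 1) * (catalan k * catalan (m - k)) := by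
    rw [← sum_range_reflect]
    apply sum_congr rfl
    intro k hk
    have : k ≤ m := by simpa [Nat.lt_succ_iff] using hk
    have e1 : m + 1 - 1 - k = m - k := by omega
    have e2 : m - (m - k) = k := by omega
    rw [e1, e2]; ring
  rw [h1, h2, h3, two_mul]
  nth_rewrite 2 [h4]
  rw [← sum_add_distrib, mul_sum]
  apply sum_congr rfl
  intro k hk
  have : k ≤ m := by simpa [Nat.lt_succ_iff] using hk
  rw [← add_mul]
  congr 1
  omega

lemma list_sum_split {l : List ℤ} {g : ℤ → ℕ} {G : ℕ → ℕ}
    (h : ∀ a y b, l = a ++ y :: b → g y = G a.length) :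
    (l.map g).sum = ∑ k ∈ Finset.range l.length, G k := by
  induction l using List.reverseRecOn with
  | nil => simp
  | append_singleton l x ih =>
    rw [List.map_append, List.sum_append, ih, List.length_append, List.length_singleton,
      Finset.sum_range_succ]
    · simp [h l x [] rfl]
    · intro a y b e
      exact h a y (b ++ [x]) (by rw [e]; simp)

lemma card_fib {A : Set (Equiv.Perm ℤ)} (hA : A.Finite) (i : ℤ) (t : List ℤ) (ht : t.Nodup)
    (h : ∀ τ ∈ A, τ i ∈ t) :
    A.ncard = (t.map fun x => {τ | τ ∈ A ∧ τ i = x}.ncard).sum := by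
  classical
  rw [Set.ncard_eq_toFinset_card _ hA,
    Finset.card_eq_sum_card_fiberwise (f := fun τ => τ i) (t := t.toFinset), List.sum_toFinset _ ht]
  · congr 1
    apply List.map_congr_left
    intro x hx
    rw [← Set.ncard_coe_finset]
    congr 1
    ext τ
    simp
  · intro τ hτ
    simp only [Set.Finite.coe_toFinset] at hτ
    simpa using h τ hτ

lemma card_par_mul {N : ℕ} {a : List ℤ} (ha : Good N a) {u : Equiv.Perm ℤ} (hu : inB N u)
    (hfix : ∀ x, (x ∈ a ∨ -x ∈ a) → u x = x) :
    (Iv N (par a * u)).ncard = (Iv N (par a)).ncard * (Iv N u).ncard := by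
  rw [← card_mul (S := {x | x ∈ a ∨ -x ∈ a}) (fun x => by simp [or_comm]) (inB_par ha) hu
    (fun x hx => by
      simp only [Set.mem_ofPred_eq, not_or] at hx
      exact par_fix hx.1 hx.2) hfix]
  congr 1
  ext τ
  simp only [Set.mem_ofPred_eq]
  refine ⟨fun h => ⟨h, fun x => ?_⟩, fun h => h.1⟩
  have hs := Iv_Fx h (sind_par ha hu fun x hx => hfix x (Or.inl hx))
  have key : ∀ z, (z ∈ a ∨ -z ∈ a) ↔ sind {x | x ∈ a} z ≠ 0 := by
    intro z
    have := ha.2.1 z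
    unfold sind
    by_cases h1 : z ∈ a
    · simp [h1, this h1]
    · by_cases h2 : -z ∈ a <;> simp [h1, h2]
  rw [key, key, hs.2]

lemma card_one (N : ℕ) : (Iv N 1).ncard = 1 := by
  have : Iv N 1 = {1} := by
    ext τ
    constructor
    · intro h
      rw [Set.mem_singleton_iff]
      ext x
      exact Iv_fix (inB_one N) h rfl
    · rintro rfl
      exact ⟨inB_one N, by simp [Ln_one]⟩
  rw [this, Set.ncard_singleton]

lemma good_tail {N : ℕ} {a b : List ℤ} (h : Good N (a ++ b)) :
    ∀ x, (x ∈ a ∨ -x ∈ a) → (x ∉ b ∧ -x ∉ b) := by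
  intro x hx
  have h1 := h.1
  rw [List.nodup_append] at h1
  rcases hx with hx | hx
  · exact ⟨fun hb => h1.2.2 x hx x hb rfl, fun hb => h.2.1 x (by simp [hx]) (by simp [hb])⟩
  · exact ⟨fun hb => h.2.1 (-x) (by simp [hx]) (by simp [hb]), fun hb => h1.2.2 _ hx _ hb rfl⟩

lemma card_par (N : ℕ) (n : ℕ) : ∀ l, Good N l → l.length = n → (Iv N (par l)).ncard = catalan n := by
  induction n using Nat.strong_induction_on with
  | _ n ih =>
  intro l hl hn
  cases l with
  | nil =>
    subst hn
    rw [par_nil, card_one]; simp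
  | cons i l' =>
    subst hn
    have hi : i ∈ signedSet N := hl.2.2 i (by simp)
    have hl' : Good N l' := hl.sub (by simp)
    have hw := inB_par hl
    rw [card_fib (finite_Iv _ _) i (i :: l') hl.1]
    · rw [List.map_cons, List.sum_cons, Iv_fixed hw hi, R1 hl, ih l'.length (by simp) l' hl' rfl]
      rw [list_sum_split (G := fun k => catalan k * catalan (l'.length - k))]
      · rw [List.length_cons, catalan_succ',
          Finset.Nat.sum_antidiagonal_eq_sum_range_succ (fun a b => catalan a * catalan b),
          Finset.sum_range_succ]
        simp [add_comm]
      · intro a y b e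
        subst e
        have hy : y ∈ signedSet N := hl.2.2 y (by simp)
        have hne := hl.ne_neg
        have hab : Good N (a ++ y :: b) := hl'
        have hb : Good N (y :: b) := hl.sub (by grind)
        have hia : Good N (i :: a) := hl.sub (by grind)
        have ha : Good N a := hl.sub (by grind)
        have hdis := good_tail (a := i :: a) (b := y :: b) hl
        have hdis2 := good_tail (a := a) (b := y :: b) hl'
        have hcomm : par (i :: a) * par (y :: b) = par (y :: b) * par (i :: a) := by
          apply Equiv.Perm.Disjoint.commute
          intro x
          by_cases hx : x ∈ i :: a ∨ -x ∈ i :: a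
          · right; exact par_fix (hdis x hx).1 (hdis x hx).2
          · left; push Not at hx; exact par_fix hx.1 hx.2
        have hd : Ln N (rfn i y * par (i :: (a ++ y :: b))) + 1 = Ln N (par (i :: (a ++ y :: b))) := by
          apply Ln_down hi.1 hy.1
          · intro v hv; exact Fx_par hl hv (by simp) (by simp)
          · refine ⟨sind {x | x ∈ y :: b}, ?_, ?_⟩
            · rw [Lp1 hl, hcomm]
              apply sind_par hb (inB_par hia)
              intro x hx
              apply par_fix
              · intro hx'; exact (hdis x (Or.inl hx')).1 hx
              · intro hx'; exact (hdis x (Or.inr hx')).1 hx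
            · intro hv
              have e1 := Fx_par hl hv (x := i) (y := y) (by simp) (by simp)
              have h2 := hdis i (by simp)
              rw [sind_zero h2.1 h2.2, sind_one (by simp) (hb.2.1 y (by simp))] at e1
              norm_num at e1
        rw [card_send hw hi hy hne.1 hd, Lp1 hl, ← mul_assoc, Equiv.Perm.mul_apply,
          par_fix (l := y :: b) (hdis i (by simp)).1 (hdis i (by simp)).2, R1 hia,
          card_par_mul ha (inB_par hb) (fun x hx => par_fix (hdis2 x hx).1 (hdis2 x hx).2),
          ih a.length (by simp) a ha rfl, ih (y :: b).length (by simp) (y :: b) hb rfl]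
        congr 2
        simp
    · intro τ hτ
      have hs := sind_par hl (inB_one N) (fun x _ => rfl)
      rw [mul_one] at hs
      have h2 := (Iv_Fx hτ hs).2 i
      rw [sind_one (z := i) (by simp) (hl.2.1 i (by simp))] at h2
      exact sind_pos h2

lemma card_bal (N : ℕ) (n : ℕ) : ∀ l, Good N l → l.length = n → (Iv N (bal l)).ncard = Nat.centralBinom n := by
  induction n using Nat.strong_induction_on with
  | _ n ih =>
  intro l hl hn
  cases l with
  | nil =>
    subst hn
    rw [bal_nil, card_one]; simp
  | cons i l' =>
    subst hn
    have hi : i ∈ signedSet N := hl.2.2 i (by simp)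
    have hl' : Good N l' := hl.sub (by simp)
    have hw := inB_bal hl
    have hvz : ∀ v ∈ Fx N (bal (i :: l')), ∀ x ∈ i :: l', v x = 0 := fun v hv x hx =>
      Fx_bal hl hv.1.1 (fun z _ => hv.2 z) hx
    rw [card_fib (finite_Iv _ _) i (i :: l' ++ ng (i :: l')) hl.nd]
    · have hS1 : (l'.map fun x => {τ | τ ∈ Iv N (bal (i :: l')) ∧ τ i = x}.ncard).sum =
          ∑ k ∈ Finset.range l'.length, catalan k * Nat.centralBinom (l'.length - k) := by
        apply list_sum_split (G := fun k => catalan k * Nat.centralBinom (l'.length - k))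
        intro a y b e
        subst e
        have hy : y ∈ signedSet N := hl.2.2 y (by simp)
        have hne := hl.ne_neg
        have hb : Good N (y :: b) := hl.sub (by grind)
        have hia : Good N (i :: a) := hl.sub (by grind)
        have ha : Good N a := hl.sub (by grind)
        have hdis := good_tail (a := i :: a) (b := y :: b) hl
        have hdis2 := good_tail (a := a) (b := y :: b) hl'
        have hd : Ln N (rfn i y * bal (i :: (a ++ y :: b))) + 1 = Ln N (bal (i :: (a ++ y :: b))) := by
          apply Ln_down hi.1 hy.1
          · intro v hv; rw [hvz v hv i (by simp), hvz v hv y (by simp)]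
          · refine ⟨sind {x | x ∈ i :: a}, ?_, ?_⟩
            · rw [Lb1 hl]
              apply sind_par hia (inB_bal hb)
              intro x hx
              exact bal_fix (hdis x (Or.inl hx)).1 (hdis x (Or.inl hx)).2
            · intro hv
              have e1 := hvz _ hv i (by simp)
              rw [sind_one (by simp) (hia.2.1 i (by simp))] at e1
              norm_num at e1
        rw [card_send hw hi hy hne.1 hd, Lb1 hl, ← mul_assoc, Equiv.Perm.mul_apply,
          bal_fix (l := y :: b) (hdis i (by simp)).1 (hdis i (by simp)).2, R1 hia,
          card_par_mul ha (inB_bal hb) (fun x hx => bal_fix (hdis2 x hx).1 (hdis2 x hx).2),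
          card_par N a.length a ha rfl, ih (y :: b).length (by simp) (y :: b) hb rfl]
        congr 2
        simp
      have hS2 : (l'.map fun x => {τ | τ ∈ Iv N (bal (i :: l')) ∧ τ i = -x}.ncard).sum =
          ∑ k ∈ Finset.range l'.length, Nat.centralBinom k * catalan (l'.length - k) := by
        apply list_sum_split (G := fun k => Nat.centralBinom k * catalan (l'.length - k))
        intro a y b e
        subst e
        have hy : y ∈ signedSet N := hl.2.2 y (by simp)
        have hy' : -y ∈ signedSet N := mem_signed_neg.2 hy
        have hne := hl.ne_neg
        have hb : Good N (y :: b) := hl.sub (by grind)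
        have hia : Good N (i :: a) := hl.sub (by grind)
        have ha : Good N a := hl.sub (by grind)
        have hdis := good_tail (a := i :: a) (b := y :: b) hl
        have hdis2 := good_tail (a := a) (b := y :: b) hl'
        have hcomm : ∀ c : List ℤ, (∀ x, (x ∈ c ∨ -x ∈ c) → x ∉ y :: b ∧ -x ∉ y :: b) →
            bal c * par (y :: b) = par (y :: b) * bal c := by
          intro c hc
          apply Equiv.Perm.Disjoint.commute
          intro x
          by_cases hx : x ∈ c ∨ -x ∈ c
          · right; exact par_fix (hc x hx).1 (hc x hx).2
          · left; push Not at hx; exact bal_fix hx.1 hx.2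
        have hd : Ln N (rfn i (-y) * bal (i :: (a ++ y :: b))) + 1 = Ln N (bal (i :: (a ++ y :: b))) := by
          apply Ln_down hi.1 hy'.1
          · intro v hv; rw [hv.1.1, hvz v hv i (by simp), hvz v hv y (by simp)]; simp
          · refine ⟨sind {x | x ∈ y :: b}, ?_, ?_⟩
            · rw [Lb2 hl, hcomm _ hdis]
              apply sind_par hb (inB_bal hia)
              intro x hx
              apply bal_fix
              · intro hx'; exact (hdis x (Or.inl hx')).1 hx
              · intro hx'; exact (hdis x (Or.inr hx')).1 hx
            · intro hv
              have e1 := hvz _ hv y (by simp)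
              rw [sind_one (by simp) (hb.2.1 y (by simp))] at e1
              norm_num at e1
        rw [card_send hw hi hy' (by intro h; exact hne.2 (by omega)) hd, Lb2 hl, ← mul_assoc,
          Equiv.Perm.mul_apply,
          par_fix (l := y :: b) (hdis i (by simp)).1 (hdis i (by simp)).2, R2 hia, hcomm _ hdis2,
          card_par_mul hb (inB_bal ha) (fun x hx => by
            apply bal_fix
            · intro hx'
              rcases hx with hx | hx
              · exact (hdis2 x (Or.inl hx')).1 hx
              · exact (hdis2 x (Or.inl hx')).2 hx
            · intro hx'
              rcases hx with hx | hx
              · exact (hdis2 x (Or.inr hx')).1 hx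
              · exact (hdis2 x (Or.inr hx')).2 hx),
          card_par N (y :: b).length (y :: b) hb rfl, ih a.length (by simp) a ha rfl, mul_comm]
        congr 2
        simp
      have hneg : {τ | τ ∈ Iv N (bal (i :: l')) ∧ τ i = -i}.ncard = catalan l'.length := by
        have hi' : -i ∈ signedSet N := mem_signed_neg.2 hi
        have hi0 := hi.1
        have hd : Ln N (rfn i (-i) * bal (i :: l')) + 1 = Ln N (bal (i :: l')) := by
          apply Ln_down hi.1 hi'.1
          · intro v hv; rw [hv.1.1, hvz v hv i (by simp)]; simp
          · refine ⟨sind {x | x ∈ i :: l'}, ?_, ?_⟩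
            · rw [Lb3 hl]
              have := sind_par hl (inB_one N) (fun x _ => rfl)
              rwa [mul_one] at this
            · intro hv
              have e1 := hvz _ hv i (by simp)
              rw [sind_one (by simp) (hl.2.1 i (by simp))] at e1
              norm_num at e1
        rw [card_send hw hi hi' (by omega) hd, Lb3 hl, R1 hl, card_par N _ l' hl' rfl]
      rw [List.map_append, List.sum_append, List.map_cons, List.sum_cons, Iv_fixed hw hi, R2 hl,
        ih l'.length (by simp) l' hl' rfl, hS1, ng_cons, List.map_cons, List.sum_cons, hneg]
      have e3 : ((ng l').map fun x => {τ | τ ∈ Iv N (bal (i :: l')) ∧ τ i = x}.ncard) =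
        (l'.map fun x => {τ | τ ∈ Iv N (bal (i :: l')) ∧ τ i = -x}.ncard) := by
        unfold ng
        rw [List.map_map]; rfl
      rw [e3, hS2, List.length_cons, catalan_cb, two_mul]
      have e4 : ∑ k ∈ Finset.range (l'.length + 1), catalan k * Nat.centralBinom (l'.length - k) =
          catalan l'.length + ∑ k ∈ Finset.range l'.length, catalan k * Nat.centralBinom (l'.length - k) := by
        rw [Finset.sum_range_succ]; simp [add_comm]
      have e5 : ∑ k ∈ Finset.range (l'.length + 1), catalan k * Nat.centralBinom (l'.length - k) =
          Nat.centralBinom l'.length + ∑ k ∈ Finset.range l'.length, Nat.centralBinom k * catalan (l'.length - k) := by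
        rw [← Finset.sum_range_reflect, Finset.sum_range_succ, add_comm]
        congr 1
        · simp
        · apply Finset.sum_congr rfl
          intro k hk
          have : k < l'.length := by simpa using hk
          have e1 : l'.length + 1 - 1 - k = l'.length - k := by omega
          have e2 : l'.length - (l'.length - k) = k := by omega
          rw [e1, e2, mul_comm]
      nth_rewrite 1 [e4]
      rw [e5]
      omega
    · intro τ hτ
      by_contra hc
      simp only [List.mem_append, not_or, mem_ng] at hc
      have h1 : bal (i :: l') (τ i) = τ i := bal_fix hc.1 hc.2
      have h2 := Iv_fix hw hτ h1
      have h3 := τ.injective h2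
      rw [h3] at hc
      simp at hc
lemma orb_self (τ : Equiv.Perm ℤ) (x : ℤ) : x ∈ permOrbit τ x := ⟨0, by simp⟩

lemma orb_step (τ : Equiv.Perm ℤ) (x : ℤ) : τ x ∈ permOrbit τ x := ⟨1, by simp⟩

lemma orb_iff (τ : Equiv.Perm ℤ) (x z : ℤ) : τ z ∈ permOrbit τ x ↔ z ∈ permOrbit τ x := by
  constructor
  · rintro ⟨m, hm⟩
    refine ⟨-1 + m, ?_⟩
    rw [zpow_add, Equiv.Perm.mul_apply, hm]; simp
  · rintro ⟨m, hm⟩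
    refine ⟨1 + m, ?_⟩
    rw [zpow_add, Equiv.Perm.mul_apply, hm]; simp

lemma pres_zpow {S : Set ℤ} {τ : Equiv.Perm ℤ} (h : ∀ x, τ x ∈ S ↔ x ∈ S) (m : ℤ) (x : ℤ) :
    (τ ^ m) x ∈ S ↔ x ∈ S := by
  induction m using Int.induction_on with
  | zero => simp
  | succ n ih => rw [add_comm, zpow_add, zpow_one, Equiv.Perm.mul_apply, h, ih]
  | pred n ih =>
    rw [← h, ← Equiv.Perm.mul_apply, ← zpow_one_add, add_comm, sub_add_cancel, ih]

lemma inB_npow {N : ℕ} {τ : Equiv.Perm ℤ} (h : inB N τ) (m : ℕ) : inB N (τ ^ m) := by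
  induction m with
  | zero => simpa using inB_one N
  | succ n ih => rw [pow_succ]; exact inB_mul ih h

lemma inB_zpow {N : ℕ} {τ : Equiv.Perm ℤ} (h : inB N τ) (m : ℤ) : inB N (τ ^ m) := by
  cases m with
  | ofNat m => simpa using inB_npow h m
  | negSucc m => rw [zpow_negSucc]; exact inB_inv (inB_npow h _)

lemma orb_sub {N : ℕ} {τ : Equiv.Perm ℤ} (h : inB N τ) {x : ℤ} (hx : x ∈ signedSet N) :
    permOrbit τ x ⊆ signedSet N := by
  rintro y ⟨m, rfl⟩
  exact (inB_mem (inB_zpow h m)).2 hx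

lemma orb_neg {N : ℕ} {τ : Equiv.Perm ℤ} (h : inB N τ) (x : ℤ) :
    negSet (permOrbit τ x) = permOrbit τ (-x) := by
  ext y
  constructor
  · rintro ⟨m, hm⟩
    exact ⟨m, by rw [(inB_zpow h m).1, hm, neg_neg]⟩
  · rintro ⟨m, hm⟩
    exact ⟨m, by rw [← hm, (inB_zpow h m).1, neg_neg]⟩

lemma Fx_char {N : ℕ} {τ : Equiv.Perm ℤ} (hτ : inB N τ) {v : ℤ → ℚ} : v ∈ Fx N τ ↔
    v ∈ Vs N ∧ ∀ A ∈ omegaTilde N τ, ∀ x ∈ A, ∀ y ∈ A, v x = v y := by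
  constructor
  · intro hv
    refine ⟨hv.1, ?_⟩
    have horb : ∀ x, ∀ y ∈ permOrbit τ x, v y = v x := by
      rintro x y ⟨m, rfl⟩
      exact vinv_zpow hv.2 m x
    rintro A (⟨⟨z, hz, rfl⟩, -⟩ | ⟨rfl, -⟩) x hx y hy
    · rw [horb z x hx, horb z y hy]
    · have hz : ∀ x ∈ ⋃₀ {A | A ∈ orbitsOn N τ ∧ negSet A = A}, v x = 0 := by
        rintro x ⟨A, ⟨⟨z, hz, rfl⟩, hA⟩, hx⟩
        have h1 : -x ∈ permOrbit τ z := by rw [← hA] at hx; exact hx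
        have h2 := horb z x hx
        have h3 := horb z _ h1
        rw [hv.1.1] at h3
        linarith
      rw [hz x hx, hz y hy]
  · rintro ⟨hv, h⟩
    refine ⟨hv, fun x => ?_⟩
    by_cases hx : x ∈ signedSet N
    · by_cases hA : negSet (permOrbit τ x) = permOrbit τ x
      · have hsub : permOrbit τ x ⊆ ⋃₀ {A | A ∈ orbitsOn N τ ∧ negSet A = A} :=
          fun y hy => ⟨permOrbit τ x, ⟨⟨x, hx, rfl⟩, hA⟩, hy⟩
        exact h _ (Or.inr ⟨rfl, ⟨x, hsub (orb_self τ x)⟩⟩) _ (hsub (orb_step τ x)) _ (hsub (orb_self τ x))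
      · exact h _ (Or.inl ⟨⟨x, hx, rfl⟩, hA⟩) _ (orb_step τ x) _ (orb_self τ x)
    · rw [hτ.2 x hx]

noncomputable def ip (N : ℕ) (u v : ℤ → ℚ) : ℚ := ∑ x ∈ Finset.Icc (-(N:ℤ)) N, u x * v x

lemma mem_Icc_signed {N : ℕ} {x : ℤ} : x ∈ Finset.Icc (-(N:ℤ)) N ↔ x = 0 ∨ x ∈ signedSet N := by
  rw [Finset.mem_Icc, ← abs_le]
  constructor
  · intro h
    by_cases h0 : x = 0
    · exact Or.inl h0
    · exact Or.inr ⟨h0, h⟩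
  · rintro (rfl | h)
    · simp
    · exact h.2

lemma ip_inv {N : ℕ} {σ : Equiv.Perm ℤ} (hσ : inB N σ) (u v : ℤ → ℚ) :
    ip N (fun x => u (σ x)) (fun x => v (σ x)) = ip N u v := by
  unfold ip
  apply Finset.sum_equiv σ
  · intro i
    have h0 : σ 0 = 0 := hσ.2 0 (by simp [signedSet])
    rw [mem_Icc_signed, mem_Icc_signed, inB_mem hσ]
    have : σ i = 0 ↔ i = 0 := by
      constructor
      · intro h; exact σ.injective (h.trans h0.symm)
      · rintro rfl; exact h0
    rw [this]
  · intro i _; rfl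

lemma Iv_sup {N : ℕ} {w τ : Equiv.Perm ℤ} (hw : Fx N w = ⊥) (h : τ ∈ Iv N w) :
    Fx N τ ⊔ Fx N (τ⁻¹ * w) = Vs N := by
  apply Submodule.eq_of_le_of_finrank_le (sup_le (Fx_le _ _) (Fx_le _ _))
  have h1 := Submodule.finrank_sup_add_finrank_inf_eq (Fx N τ) (Fx N (τ⁻¹ * w))
  rw [Iv_inf h, hw, finrank_bot] at h1
  have h2 := Ln_add N τ
  have h3 := Ln_add N (τ⁻¹ * w)
  have h4 := Ln_add N w
  have h5 : dd N w = 0 := by unfold dd; rw [hw, finrank_bot]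
  have h6 := h.2
  unfold dd DD at *
  omega

lemma Fx_act {N : ℕ} {w τ : Equiv.Perm ℤ} {k : ℤ → ℚ} (hk : k ∈ Fx N (τ⁻¹ * w)) (z : ℤ) :
    k (τ⁻¹ z) = k (w⁻¹ z) := by
  have := hk.2 (w⁻¹ z)
  rw [Equiv.Perm.mul_apply] at this
  simpa using this

lemma Fx_act' {N : ℕ} {τ : Equiv.Perm ℤ} {k : ℤ → ℚ} (hk : k ∈ Fx N τ) (z : ℤ) :
    k (τ⁻¹ z) = k z := by
  have := hk.2 (τ⁻¹ z)
  simpa using this.symm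

lemma Fx_determines {N : ℕ} {w τ τ' : Equiv.Perm ℤ} (hwB : inB N w) (hw : Fx N w = ⊥) (h : τ ∈ Iv N w)
    (h' : τ' ∈ Iv N w) (hF : Fx N τ = Fx N τ') : τ = τ' := by
  have hK : ∀ k ∈ Fx N (τ⁻¹ * w), k ∈ Fx N (τ'⁻¹ * w) := by
    intro k hk
    have hkV : k ∈ Fx N τ' ⊔ Fx N (τ'⁻¹ * w) := by rw [Iv_sup hw h']; exact hk.1
    obtain ⟨f, hf, k', hk', rfl⟩ := Submodule.mem_sup.1 hkV
    have hf' : f ∈ Fx N τ := by rw [hF]; exact hf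
    have e1 : ip N (fun x => (f + k') (τ⁻¹ x)) f = ip N (f + k') f := by
      rw [← ip_inv (inB_inv h.1) (f + k') f]
      congr 1
      ext x; exact (Fx_act' hf' x).symm
    have e2 : ip N (fun x => k' (τ'⁻¹ x)) f = ip N k' f := by
      rw [← ip_inv (inB_inv h'.1) k' f]
      congr 1
      ext x; exact (Fx_act' hf x).symm
    have e3 := ip_inv (inB_inv hwB) f f
    have e4 : ip N (fun x => (f + k') (τ⁻¹ x)) f =
        ip N (fun x => f (w⁻¹ x)) f + ip N (fun x => k' (τ'⁻¹ x)) f := by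
      unfold ip
      rw [← Finset.sum_add_distrib]
      apply Finset.sum_congr rfl
      intro x _
      beta_reduce
      rw [Fx_act hk, Fx_act hk', Pi.add_apply, add_mul]
    have e5 : ip N (f + k') f = ip N f f + ip N k' f := by
      unfold ip
      rw [← Finset.sum_add_distrib]
      apply Finset.sum_congr rfl
      intro x _
      rw [Pi.add_apply, add_mul]
    have e6 : ip N (fun x => f (w⁻¹ x)) f = ip N f f := by linarith
    have e7 : ∑ x ∈ Finset.Icc (-(N:ℤ)) N, (f (w⁻¹ x) - f x) ^ 2 = 0 := by
      have : ∑ x ∈ Finset.Icc (-(N:ℤ)) N, (f (w⁻¹ x) - f x) ^ 2 =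
          ip N (fun x => f (w⁻¹ x)) (fun x => f (w⁻¹ x)) + ip N f f - 2 * ip N (fun x => f (w⁻¹ x)) f := by
        unfold ip
        rw [Finset.mul_sum, ← Finset.sum_add_distrib, ← Finset.sum_sub_distrib]
        apply Finset.sum_congr rfl
        intro x _
        ring
      rw [this, e3, e6]; ring
    have e8 : ∀ x, f (w⁻¹ x) = f x := by
      intro x
      by_cases hx : x ∈ signedSet N
      · have := (Finset.sum_eq_zero_iff_of_nonneg (fun x _ => sq_nonneg _)).1 e7 x (mem_Icc_signed.2 (Or.inr hx))
        have := pow_eq_zero_iff (two_ne_zero) |>.1 this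
        linarith
      · rw [(inB_inv hwB).2 x hx]
    have e9 : f ∈ Fx N w := by
      rw [← Fx_inv]; exact ⟨hf.1, e8⟩
    rw [hw, Submodule.mem_bot] at e9
    rw [e9, zero_add]; exact hk'
  have hV : ∀ v ∈ Vs N, ∀ z, v (τ⁻¹ z) = v (τ'⁻¹ z) := by
    intro v hv z
    rw [← Iv_sup hw h] at hv
    obtain ⟨f, hf, k, hk, rfl⟩ := Submodule.mem_sup.1 hv
    have hf' : f ∈ Fx N τ' := by rw [← hF]; exact hf
    simp only [Pi.add_apply]
    rw [Fx_act' hf, Fx_act' hf', Fx_act hk, Fx_act (hK k hk)]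
  ext x
  by_cases hx : x ∈ signedSet N
  · have hsub : ({x} : Set ℤ) ⊆ signedSet N := by simpa using hx
    have h1 := hV _ (sind_Vs hsub) (τ x)
    have hx0 := hx.1
    have hxx : τ⁻¹ (τ x) = x := by simp
    rw [hxx, sind_one (z := x) (by simp) (by simp; omega)] at h1
    have h2 := sind_pos h1.symm
    rw [Set.mem_singleton_iff, Equiv.Perm.inv_eq_iff_eq] at h2
    exact h2
  · rw [h.1.2 x hx, h'.1.2 x hx]

lemma omega_inj {N : ℕ} {w : Equiv.Perm ℤ} (hwB : inB N w) (hw : Fx N w = ⊥) :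
    Set.InjOn (omegaTilde N) (Iv N w) := by
  intro τ h τ' h' e
  apply Fx_determines hwB hw h h'
  ext v
  rw [Fx_char h.1, Fx_char h'.1, e]

lemma min_neg {N : ℕ} {τ : Equiv.Perm ℤ} (hτ : inB N τ) {y : ℤ} (hy : y ≠ 0) (h : -y ∈ permOrbit τ y) :
    ∃ m : ℕ, (τ ^ (m + 1)) y = -y ∧ ∀ k ≤ m, (τ ^ k) y ≠ -y ∧ (0 < k → (τ ^ k) y ≠ y) := by
  classical
  have hex : ∃ m : ℕ, (τ ^ m) y = -y := by
    obtain ⟨m, hm⟩ := h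
    cases m with
    | ofNat m => exact ⟨m, by simpa using hm⟩
    | negSucc m =>
      refine ⟨m + 1, ?_⟩
      rw [zpow_negSucc, Equiv.Perm.inv_eq_iff_eq, (inB_npow hτ _).1] at hm
      omega
  have hs := Nat.find_spec hex
  have hmin := fun k => Nat.find_min hex (m := k)
  generalize Nat.find hex = n at hs hmin
  cases n with
  | zero => simp at hs; omega
  | succ n =>
    refine ⟨n, hs, fun k hk => ⟨hmin k (by omega), fun hk0 hk1 => ?_⟩⟩
    apply hmin (n + 1 - k) (by omega)
    have : (τ ^ (n + 1 - k + k)) y = -y := by rw [Nat.sub_add_cancel (by omega)]; exact hs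
    rwa [pow_add, Equiv.Perm.mul_apply, hk1] at this

lemma Ln_neg {N : ℕ} {τ : Equiv.Perm ℤ} (hτ : inB N τ) {y : ℤ} (hy : y ∈ signedSet N)
    (h : -y ∈ permOrbit τ y) : Ln N (rfn y (-y) * τ) + 1 = Ln N τ := by
  have hy0 := hy.1
  have hv : ∀ v ∈ Fx N τ, v y = v (-y) := by
    intro v hv
    obtain ⟨m, hm⟩ := h
    have := vinv_zpow hv.2 m y
    rw [hm] at this
    exact this.symm
  apply Ln_down hy0 (by omega) hv
  obtain ⟨m, hm, hmin⟩ := min_neg hτ hy0 h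
  have hmin0 := hmin 0 (by omega)
  have hss : inB N (rfn y (-y)) := inB_rfn hy (mem_signed_neg.2 hy)
  have hsub : {z | ∃ k ≤ m, (τ ^ k) y = z} ⊆ signedSet N := by
    rintro z ⟨k, -, rfl⟩
    exact (inB_mem (inB_npow hτ k)).2 hy
  have hr : ∀ z, z ≠ y → z ≠ -y → rfn y (-y) z = z := by
    intro z h1 h2
    rw [rfn_apply hy0 (by omega)]
    split_ifs <;> omega
  have hr2 : rfn y (-y) (-y) = y := by
    rw [rfn_apply hy0 (by omega)]
    split_ifs <;> omega
  refine ⟨sind {z | ∃ k ≤ m, (τ ^ k) y = z}, sind_Fx hsub (inB_mul hss hτ) ?_, ?_⟩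
  · intro z
    constructor
    · rintro ⟨k, hk, hz⟩
      rw [Equiv.Perm.mul_apply] at hz
      have hz2 : τ z = rfn y (-y) ((τ ^ k) y) := by
        rw [hz, ← Equiv.Perm.mul_apply, rfn_mul_self hy0 (by omega)]; rfl
      cases k with
      | zero =>
        refine ⟨m, le_rfl, ?_⟩
        apply τ.injective
        rw [← Equiv.Perm.mul_apply, ← pow_succ', hm, hz2, rfn_apply hy0 (by omega)]
        simp
      | succ k =>
        refine ⟨k, by omega, ?_⟩
        rw [hr _ ((hmin _ hk).2 (by omega)) (hmin _ hk).1] at hz2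
        apply τ.injective
        rw [← Equiv.Perm.mul_apply, ← pow_succ', hz2]
    · rintro ⟨k, hk, rfl⟩
      rw [Equiv.Perm.mul_apply, ← Equiv.Perm.mul_apply τ, ← pow_succ']
      rcases eq_or_lt_of_le hk with rfl | hk
      · exact ⟨0, by omega, by rw [hm, hr2]; rfl⟩
      · exact ⟨k + 1, hk, by rw [hr _ ((hmin _ hk).2 (by omega)) (hmin _ hk).1]⟩
  · intro hc
    have h1 := hv _ hc
    rw [hc.1.1, sind_one] at h1
    · norm_num at h1
    · exact ⟨0, by omega, rfl⟩
    · rintro ⟨k, hk, hz⟩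
      exact (hmin k hk).1 hz

lemma orb_neg_of_bot {N : ℕ} {γ : Equiv.Perm ℤ} (hγ : inB N γ) (hb : Fx N γ = ⊥) {x : ℤ}
    (hx : x ∈ signedSet N) : -x ∈ permOrbit γ x := by
  by_contra hc
  have h1 := sind_Fx (orb_sub hγ hx) hγ (orb_iff γ x)
  rw [hb, Submodule.mem_bot] at h1
  have h2 := sind_one (orb_self γ x) hc
  rw [h1] at h2
  simp at h2

lemma walk {N : ℕ} {γ ρ : Equiv.Perm ℤ} (hγ : inB N γ) {x : ℤ} (hx : x ≠ 0) (h : -x ∈ permOrbit γ x)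
    {v : ℤ → ℚ} (hv : ∀ z, v (ρ (γ z)) = v z)
    (hρ : ∀ k : ℕ, (γ ^ k) x ≠ x → (γ ^ k) x ≠ -x → ρ ((γ ^ k) x) = (γ ^ k) x) :
    v (ρ (-x)) = v x := by
  obtain ⟨m, hm, hmin⟩ := min_neg hγ hx h
  have h1 : ∀ k ≤ m, v ((γ ^ k) x) = v x := by
    intro k hk
    induction k with
    | zero => simp
    | succ k ih =>
      rw [← ih (by omega), ← hv ((γ ^ k) x), ← Equiv.Perm.mul_apply γ, ← pow_succ',
        hρ _ ((hmin _ hk).2 (by omega)) (hmin _ hk).1]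
  rw [← h1 m le_rfl, ← hv ((γ ^ m) x), ← Equiv.Perm.mul_apply γ, ← pow_succ', hm]

lemma no_cross {N : ℕ} {γ τ : Equiv.Perm ℤ} (hγ : inB N γ) (hb : Fx N γ = ⊥) {S : Set ℤ}
    (hS : ∀ x, -x ∈ S ↔ x ∈ S) (hγS : ∀ x, γ x ∈ S ↔ x ∈ S) (h : τ ∈ Iv N γ) {x : ℤ}
    (hx : x ∈ signedSet N) (hxy : ¬ (τ x ∈ S ↔ x ∈ S)) (horb : -(τ x) ∈ permOrbit τ (τ x)) : False := by
  have hy : τ x ∈ signedSet N := (inB_mem h.1).2 hx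
  have hs := Ln_neg h.1 hy horb
  have hx0 := hx.1
  have hy0 := hy.1
  have hy' := mem_signed_neg.2 hy
  have hsB := inB_rfn hy hy'
  have hne1 : τ x ≠ x := fun e => hxy (by rw [e])
  have hne2 : τ x ≠ -x := fun e => hxy (by rw [e, hS])
  generalize hyd : τ x = y at *
  have hst : (rfn y (-y) * τ) x = -y := by
    rw [Equiv.Perm.mul_apply, hyd, rfn_apply hy0 (by omega)]; simp
  have h2 := Ln_fix hx (inB_mul hsB h.1) (by rw [hst]; omega)
  rw [hst] at h2
  have hκ : Ln N (rfn x (-y) * (rfn y (-y) * γ)) + 2 ≤ Ln N γ := by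
    have e : rfn x (-y) * (rfn y (-y) * γ) = (rfn x (-y) * (rfn y (-y) * τ)) * (τ⁻¹ * γ) := by group
    rw [e]
    have := Ln_mul N (rfn x (-y) * (rfn y (-y) * τ)) (τ⁻¹ * γ)
    have := h.2
    omega
  have hρ : ∀ z, (rfn x (-y) * rfn y (-y)) z = if z = x then -y else if z = -x then y else
      if z = y then x else if z = -y then -x else z := by
    intro z
    rw [Equiv.Perm.mul_apply, rfn_apply hy0 (by omega), rfn_apply hx0 (by omega)]
    split_ifs <;> omega
  rw [← mul_assoc] at hκ
  generalize rfn x (-y) * rfn y (-y) = ρ at *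
  have hpow : ∀ (k : ℕ) z, (γ ^ k) z ∈ S ↔ z ∈ S := fun k z => by
    have := pres_zpow hγS (k : ℤ) z
    simpa using this
  have hbot : Fx N (ρ * γ) = ⊥ := by
    rw [eq_bot_iff]
    intro v hv
    have hv2 : ∀ z, v (ρ (γ z)) = v z := hv.2
    have w1 := walk hγ hx0 (orb_neg_of_bot hγ hb hx) hv2 (by
      intro k h1 h2
      have h3 : (γ ^ k) x ≠ y := fun e => hxy (by rw [← e, hpow])
      have h4 : (γ ^ k) x ≠ -y := fun e => hxy (by rw [← hS, ← e, hpow])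
      rw [hρ, if_neg h1, if_neg h2, if_neg h3, if_neg h4])
    have w2 := walk hγ hy0 (orb_neg_of_bot hγ hb hy) hv2 (by
      intro k h1 h2
      have h3 : (γ ^ k) y ≠ x := fun e => hxy (by rw [← e, hpow])
      have h4 : (γ ^ k) y ≠ -x := fun e => hxy (by rw [← hS x, ← e, hpow])
      rw [hρ, if_neg h3, if_neg h4, if_neg h1, if_neg h2])
    have r1 : ρ (-x) = y := by rw [hρ]; split_ifs <;> omega
    have r2 : ρ (-y) = -x := by rw [hρ]; split_ifs <;> omega
    rw [r1] at w1
    rw [r2, hv.1.1] at w2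
    have vx : v x = 0 := by linarith
    have vy : v y = 0 := by linarith
    have vr : ∀ z, v (ρ z) = v z := by
      intro z
      rw [hρ]
      split_ifs with h1 h2 h3 h4
      · rw [h1, hv.1.1, vx, vy]; simp
      · rw [h2, hv.1.1, vx, vy]; simp
      · rw [h3, vx, vy]
      · rw [h4, hv.1.1, hv.1.1, vx, vy]
      · rfl
    rw [← hb]
    exact ⟨hv.1, fun z => by rw [← vr, hv2]⟩
  have h5 := Ln_add N (ρ * γ)
  have h6 := Ln_add N γ
  have h7 : dd N (ρ * γ) = 0 := by unfold dd; rw [hbot, finrank_bot]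
  omega
def L1 (p : ℕ) : List ℤ := (List.range p).map fun i => ((i : ℤ) + 1)
def L2 (p q : ℕ) : List ℤ := (List.range q).map fun i => ((p : ℤ) + (i : ℤ) + 1)

lemma L1_eq (p : ℕ) : L1 p = (List.range p).map fun i : ℕ => ((i : ℤ) + 1) := by
  simp only [L1, List.map_flatMap, List.bind_eq_flatMap, List.pure_def, List.map_cons, List.map_nil]
  exact List.flatMap_pure_eq_map _ _

lemma L2_eq (p q : ℕ) : L2 p q = (List.range q).map fun i : ℕ => ((p : ℤ) + (i : ℤ) + 1) := by
  simp only [L2, List.map_flatMap, List.bind_eq_flatMap, List.pure_def, List.map_cons, List.map_nil]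
  exact List.flatMap_pure_eq_map _ _

lemma mem_L1 {p : ℕ} {x : ℤ} : x ∈ L1 p ↔ 1 ≤ x ∧ x ≤ p := by
  rw [L1_eq, List.mem_map]
  constructor
  · rintro ⟨i, hi, rfl⟩
    rw [List.mem_range] at hi
    omega
  · rintro ⟨h1, h2⟩
    exact ⟨(x - 1).toNat, by rw [List.mem_range]; omega, by omega⟩

lemma mem_L2 {p q : ℕ} {x : ℤ} : x ∈ L2 p q ↔ p + 1 ≤ x ∧ x ≤ p + q := by
  rw [L2_eq, List.mem_map]
  constructor
  · rintro ⟨i, hi, rfl⟩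
    rw [List.mem_range] at hi
    omega
  · rintro ⟨h1, h2⟩
    exact ⟨(x - 1 - p).toNat, by rw [List.mem_range]; omega, by omega⟩

lemma mem_signed {N : ℕ} {x : ℤ} : x ∈ signedSet N ↔ x ≠ 0 ∧ -(N:ℤ) ≤ x ∧ x ≤ N := by
  rw [← abs_le]; rfl

lemma good_L1 (p q : ℕ) : Good (p + q) (L1 p) := by
  refine ⟨by rw [L1_eq]; exact List.Nodup.map (fun a b h => by simpa using h) List.nodup_range, ?_, ?_⟩
  · intro x hx hx'
    rw [mem_L1] at hx hx'; omega
  · intro x hx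
    rw [mem_L1] at hx
    rw [mem_signed]; push_cast; omega

lemma good_L2 (p q : ℕ) : Good (p + q) (L2 p q) := by
  refine ⟨by rw [L2_eq]; exact List.Nodup.map (fun a b h => by simpa using h) List.nodup_range, ?_, ?_⟩
  · intro x hx hx'
    rw [mem_L2] at hx hx'; omega
  · intro x hx
    rw [mem_L2] at hx
    rw [mem_signed]; push_cast; omega

lemma gamma_eq (p q : ℕ) : gammaPQ p q = bal (L1 p) * bal (L2 p q) := by
  unfold gammaPQ bal L1 L2 ng
  rw [List.map_map, List.map_map]
  rfl

lemma bal_mem {l : List ℤ} {x : ℤ} : (bal l x ∈ l ∨ -(bal l x) ∈ l) ↔ (x ∈ l ∨ -x ∈ l) := by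
  have h := List.formPerm_mem_iff_mem (l := l ++ ng l) (x := x)
  simp only [List.mem_append, mem_ng] at h
  exact h

lemma S_iff {p : ℕ} {x : ℤ} : x ∈ signedSet p ↔ (x ∈ L1 p ∨ -x ∈ L1 p) := by
  rw [mem_signed, mem_L1, mem_L1]; omega

lemma bal1_fix {p : ℕ} {x : ℤ} (h : x ∉ signedSet p) : bal (L1 p) x = x := by
  rw [S_iff, not_or] at h
  exact bal_fix h.1 h.2

lemma bal2_fix {p q : ℕ} {x : ℤ} (h : x ∈ signedSet p) : bal (L2 p q) x = x := by
  rw [mem_signed] at h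
  apply bal_fix <;> rw [mem_L2] <;> omega

lemma bal1_mem {p : ℕ} {x : ℤ} : bal (L1 p) x ∈ signedSet p ↔ x ∈ signedSet p := by
  rw [S_iff, S_iff, bal_mem]

lemma bal2_mem {p q : ℕ} {x : ℤ} : bal (L2 p q) x ∈ signedSet p ↔ x ∈ signedSet p := by
  constructor
  · intro h
    have := bal2_fix (q := q) h
    have := (bal (L2 p q)).injective this
    rwa [this] at h
  · intro h; rwa [bal2_fix h]

lemma gamma_mem {p q : ℕ} {x : ℤ} : gammaPQ p q x ∈ signedSet p ↔ x ∈ signedSet p := by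
  rw [gamma_eq, Equiv.Perm.mul_apply, bal1_mem, bal2_mem]

lemma inB_gamma (p q : ℕ) : inB (p + q) (gammaPQ p q) := by
  rw [gamma_eq]; exact inB_mul (inB_bal (good_L1 p q)) (inB_bal (good_L2 p q))

lemma Fx_gamma (p q : ℕ) : Fx (p + q) (gammaPQ p q) = ⊥ := by
  rw [eq_bot_iff]
  intro v hv
  have hv2 := hv.2
  rw [gamma_eq] at hv2
  have h1 : ∀ x ∈ L1 p, v x = 0 := fun x hx => by
    refine Fx_bal (good_L1 p q) hv.1.1 (fun z hz => ?_) hx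
    have := hv2 z
    rwa [Equiv.Perm.mul_apply, bal2_fix (S_iff.2 hz)] at this
  have h2 : ∀ x ∈ L2 p q, v x = 0 := fun x hx => by
    refine Fx_bal (good_L2 p q) hv.1.1 (fun z hz => ?_) hx
    have := hv2 z
    rwa [Equiv.Perm.mul_apply, bal1_fix] at this
    rw [bal2_mem, mem_signed]
    rw [mem_L2, mem_L2] at hz
    omega
  rw [Submodule.mem_bot]
  ext x
  show v x = 0
  by_cases hx : x ∈ signedSet (p + q)
  · rw [mem_signed] at hx
    push_cast at hx
    have h3 : x ∈ L1 p ∨ -x ∈ L1 p ∨ x ∈ L2 p q ∨ -x ∈ L2 p q := by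
      simp only [mem_L1, mem_L2]; omega
    have h4 := hv.1.1 x
    rcases h3 with h | h | h | h
    · exact h1 x h
    · rw [h1 _ h] at h4; linarith
    · exact h2 x h
    · rw [h2 _ h] at h4; linarith
  · exact hv.1.2 x hx

lemma SncB_eq (p q : ℕ) : SncB p q = Iv (p + q) (gammaPQ p q) := by
  ext τ
  constructor
  · rintro ⟨h1, h2⟩
    refine ⟨h1, ?_⟩
    unfold leB at h2
    rwa [lenB_eq (inB_gamma p q), lenB_eq h1, lenB_eq (inB_mul (inB_inv h1) (inB_gamma p q))] at h2
  · rintro ⟨h1, h2⟩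
    refine ⟨h1, ?_⟩
    unfold leB
    rwa [lenB_eq (inB_gamma p q), lenB_eq h1, lenB_eq (inB_mul (inB_inv h1) (inB_gamma p q))]

lemma finite_omega (N : ℕ) (τ : Equiv.Perm ℤ) : (omegaTilde N τ).Finite := by
  have hs : (signedSet N).Finite := by
    apply (Set.finite_Icc (-(N:ℤ)) N).subset
    intro x hx
    exact abs_le.1 hx.2
  apply Set.Finite.union
  · apply (hs.image (permOrbit τ)).subset
    rintro A ⟨⟨x, hx, rfl⟩, -⟩
    exact ⟨x, hx, rfl⟩
  · apply (Set.finite_singleton (⋃₀ {A | A ∈ orbitsOn N τ ∧ negSet A = A})).subset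
    rintro A ⟨h, -⟩
    exact h

lemma inner_iff {p q : ℕ} {x : ℤ} : x ∈ innerSet p q ↔ x ∈ signedSet (p + q) ∧ x ∉ signedSet p := by
  rw [mem_signed, mem_signed]
  show ((p : ℤ) < |x| ∧ |x| ≤ (p : ℤ) + (q : ℤ)) ↔ _
  rw [abs_le, lt_abs]
  push_cast
  omega

lemma negSet_negSet (A : Set ℤ) : negSet (negSet A) = A := by
  ext x
  show - -x ∈ A ↔ x ∈ A
  rw [neg_neg]

lemma conn_zero {p q : ℕ} {τ : Equiv.Perm ℤ} (h : τ ∈ Iv (p + q) (gammaPQ p q)) :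
    connectivity p q (omegaTilde (p + q) τ) = 0 ↔ ∀ x, τ x ∈ signedSet p ↔ x ∈ signedSet p := by
  constructor
  · intro hc x
    by_contra hxy
    have hx : x ∈ signedSet (p + q) := by
      by_contra hx
      exact hxy (by rw [h.1.2 x hx])
    have hy := (inB_mem h.1).2 hx
    by_cases hA : negSet (permOrbit τ x) = permOrbit τ x
    · apply no_cross (inB_gamma p q) (Fx_gamma p q) (S := signedSet p) (fun x => mem_signed_neg)
        (fun x => gamma_mem) h hx hxy
      have h1 : -(τ x) ∈ permOrbit τ x := by
        have := orb_step τ x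
        rw [← hA] at this
        exact this
      obtain ⟨m, hm⟩ := h1
      refine ⟨m - 1, ?_⟩
      rw [← Equiv.Perm.mul_apply, ← zpow_add_one, sub_add_cancel, hm]
    · have hmeet : (permOrbit τ x ∩ signedSet p).Nonempty ∧ (permOrbit τ x ∩ innerSet p q).Nonempty := by
        by_cases hxs : x ∈ signedSet p
        · exact ⟨⟨x, orb_self τ x, hxs⟩, ⟨τ x, orb_step τ x, inner_iff.2 ⟨hy, fun hh => hxy (by tauto)⟩⟩⟩
        · refine ⟨⟨τ x, orb_step τ x, by tauto⟩, ⟨x, orb_self τ x, inner_iff.2 ⟨hx, hxs⟩⟩⟩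
      have hsubset : ({permOrbit τ x, negSet (permOrbit τ x)} : Set (Set ℤ)) ⊆
          {A | A ∈ omegaTilde (p + q) τ ∧ negSet A ≠ A ∧ (A ∩ signedSet p).Nonempty ∧
            (A ∩ innerSet p q).Nonempty} := by
        rintro A (rfl | rfl)
        · exact ⟨Or.inl ⟨⟨x, hx, rfl⟩, hA⟩, hA, hmeet⟩
        · have hA' : negSet (negSet (permOrbit τ x)) ≠ negSet (permOrbit τ x) := by
            rw [negSet_negSet]; exact Ne.symm hA
          refine ⟨Or.inl ⟨⟨-x, mem_signed_neg.2 hx, orb_neg h.1 x⟩, hA'⟩, hA', ?_, ?_⟩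
          · obtain ⟨z, hz1, hz2⟩ := hmeet.1
            exact ⟨-z, by show - -z ∈ permOrbit τ x; rwa [neg_neg], mem_signed_neg.2 hz2⟩
          · obtain ⟨z, hz1, hz2⟩ := hmeet.2
            refine ⟨-z, by show - -z ∈ permOrbit τ x; rwa [neg_neg], ?_⟩
            rw [inner_iff] at hz2 ⊢
            rwa [mem_signed_neg, mem_signed_neg]
      have hfin := (finite_omega (p + q) τ).subset
        (t := {A | A ∈ omegaTilde (p + q) τ ∧ negSet A ≠ A ∧ (A ∩ signedSet p).Nonempty ∧
            (A ∩ innerSet p q).Nonempty}) (fun A hA => hA.1)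
      have h2 := Set.ncard_le_ncard hsubset hfin
      rw [Set.ncard_pair (Ne.symm hA)] at h2
      unfold connectivity at hc
      omega
  · intro hS
    unfold connectivity
    have : {A | A ∈ omegaTilde (p + q) τ ∧ negSet A ≠ A ∧ (A ∩ signedSet p).Nonempty ∧
            (A ∩ innerSet p q).Nonempty} = ∅ := by
      rw [Set.eq_empty_iff_forall_notMem]
      rintro A ⟨hA, hne, ⟨z, hz1, hz2⟩, ⟨u, hu1, hu2⟩⟩
      rcases hA with ⟨⟨x, hx, rfl⟩, -⟩ | ⟨rfl, -⟩
      · obtain ⟨m, rfl⟩ := hz1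
        obtain ⟨k, rfl⟩ := hu1
        rw [pres_zpow hS] at hz2
        rw [inner_iff, pres_zpow hS] at hu2
        exact hu2.2 hz2
      · apply hne
        have aux : ∀ y, y ∈ ⋃₀ {A | A ∈ orbitsOn (p + q) τ ∧ negSet A = A} →
            -y ∈ ⋃₀ {A | A ∈ orbitsOn (p + q) τ ∧ negSet A = A} := by
          rintro y ⟨A, hA, hy⟩
          refine ⟨A, hA, ?_⟩
          rw [← hA.2] at hy
          exact hy
        ext y
        constructor
        · intro hy
          have := aux _ hy
          rwa [neg_neg] at this
        · exact aux y
    rw [this]; simp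

/-- The number of partitions in `NC^B(p,q)` with connectivity `0` is
`C(2p,p)·C(2q,q)`. -/
theorem ncb_conn_zero_card (p q : ℕ) (hp : 1 ≤ p) (hq : 1 ≤ q) :
    {π | π ∈ NCB p q ∧ connectivity p q π = 0}.ncard =
      Nat.choose (2 * p) p * Nat.choose (2 * q) q := by
  have e : {π | π ∈ NCB p q ∧ connectivity p q π = 0} = omegaTilde (p + q) ''
      {τ | τ ∈ Iv (p + q) (gammaPQ p q) ∧ ∀ x, τ x ∈ signedSet p ↔ x ∈ signedSet p} := by
    ext π
    constructor
    · rintro ⟨⟨τ, hτ, rfl⟩, hc⟩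
      rw [SncB_eq] at hτ
      exact ⟨τ, ⟨hτ, (conn_zero hτ).1 hc⟩, rfl⟩
    · rintro ⟨τ, ⟨hτ, hS⟩, rfl⟩
      exact ⟨⟨τ, by rw [SncB_eq]; exact hτ, rfl⟩, (conn_zero hτ).2 hS⟩
  rw [e, Set.InjOn.ncard_image ((omega_inj (inB_gamma p q) (Fx_gamma p q)).mono fun τ hτ => hτ.1),
    gamma_eq, card_mul (fun x => mem_signed_neg) (inB_bal (good_L1 p q)) (inB_bal (good_L2 p q))
      (fun x hx => bal1_fix hx) (fun x hx => bal2_fix hx),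
    card_bal _ p _ (good_L1 p q) (by simp [L1]), card_bal _ q _ (good_L2 p q) (by simp [L2])]
  rfl
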